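/- arXiv:1612.03534 — 14 statements merged into one kernel-verified Lean document; each statement's English description precedes it below -/
import Mathlib

section
/- Let K be a field of characteristic different from 3, let L/K be a separable field extension of degree 3, and let y be a primitive element of L/K with minimal polynomial X^3 + eX^2 + fX + g over K (e, f, g ∈ K). (a) If 3eg ≠ f^2, then there exists a primitive element z of L/K whose minimal polynomial over K has the form X^3 + X^2 + b for some b ∈ K. (b) If 3eg = f^2, then there exists a primitive element z of L/K whose minimal polynomial over K has the form X^3 − b for some b ∈ K. -/
open Polynomial

theorem ne_zero_of_adjoin_simple_eq_top {K L : Type*} [Field K] [Field L] [Algebra K L]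
    (hdeg : Module.finrank K L ≠ 1) {z : L} (hz : IntermediateField.adjoin K {z} = ⊤) :
    z ≠ 0 := by
  rintro rfl
  rw [IntermediateField.adjoin_zero] at hz
  apply hdeg
  rw [← IntermediateField.finrank_top' (F := K) (E := L), ← hz, IntermediateField.finrank_bot]

theorem adjoin_simple_eq_top_of_mem {K L : Type*} [Field K] [Field L] [Algebra K L] {y z : L}
    (hy : IntermediateField.adjoin K {y} = ⊤) (h : y ∈ IntermediateField.adjoin K {z}) :
    IntermediateField.adjoin K {z} = ⊤ := by
  rw [eq_top_iff, ← hy]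
  exact IntermediateField.adjoin_simple_le_iff.mpr h

theorem minpoly_eq_of_adjoin_simple_eq_top {K L : Type*} [Field K] [Field L] [Algebra K L]
    [FiniteDimensional K L] {z : L} (hz : IntermediateField.adjoin K {z} = ⊤) {P : K[X]}
    (hP : P.Monic) (hdeg : P.natDegree = Module.finrank K L) (hroot : aeval z P = 0) :
    minpoly K z = P := by
  have hint : IsIntegral K z := IsIntegral.of_finite K z
  refine (eq_of_monic_of_dvd_of_natDegree_le (minpoly.monic hint) hP
    (minpoly.dvd K z hroot) ?_).symm
  rw [hdeg, ← IntermediateField.adjoin.finrank hint, hz, IntermediateField.finrank_top']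

theorem exists_generator_depressed_cubic {K L : Type*} [Field K] [Field L] [Algebra K L]
    (h3 : (3 : K) ≠ 0) (hdeg : Module.finrank K L = 3) {y : L} {e f g : K}
    (hy : IntermediateField.adjoin K {y} = ⊤) (hg : g ≠ 0)
    (hroot : y ^ 3 + algebraMap K L e * y ^ 2 + algebraMap K L f * y + algebraMap K L g = 0) :
    ∃ (u : L) (q : K), IntermediateField.adjoin K {u} = ⊤ ∧
      u ^ 3 + algebraMap K L ((3 * e * g - f ^ 2) / (3 * g ^ 2)) * u + algebraMap K L q = 0 := by
  have hy0 : y ≠ 0 := ne_zero_of_adjoin_simple_eq_top (by omega) hy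
  have hg' : algebraMap K L g ≠ 0 := by simpa using hg
  have h3' : (3 : L) ≠ 0 := by
    rw [← map_ofNat (algebraMap K L) 3]
    exact (_root_.map_ne_zero _).mpr h3
  refine ⟨y⁻¹ + algebraMap K L (f / (3 * g)),
    2 * (f / (3 * g)) ^ 3 - e / g * (f / (3 * g)) + 1 / g,
    adjoin_simple_eq_top_of_mem hy ?_, ?_⟩
  · set u := y⁻¹ + algebraMap K L (f / (3 * g)) with hu
    have : y = (u - algebraMap K L (f / (3 * g)))⁻¹ := by simp [hu]
    rw [this]
    exact inv_mem (sub_mem (IntermediateField.mem_adjoin_simple_self K u)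
      (IntermediateField.algebraMap_mem _ _))
  · simp only [map_add, map_sub, map_mul, map_div₀, map_pow, map_one, map_ofNat]
    field_simp
    linear_combination (27 * algebraMap K L g ^ 2) * hroot

/-- Let K be a field of characteristic different from 3, let L/K be a separable field
extension of degree 3, and let y be a primitive element of L/K with minimal polynomial
X^3 + eX^2 + fX + g over K. (a) If 3eg ≠ f^2, then there exists a primitive element z of
L/K whose minimal polynomial over K has the form X^3 + X^2 + b for some b ∈ K.
(b) If 3eg = f^2, then there exists a primitive element z of L/K whose minimal polynomial
over K has the form X^3 − b for some b ∈ K. -/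
theorem cubic_generator_normal_forms
    (K L : Type*) [Field K] [Field L] [Algebra K L]
    (hchar : ringChar K ≠ 3)
    [Algebra.IsSeparable K L]
    (hdeg : Module.finrank K L = 3)
    (y : L) (e f g : K)
    (hy : IntermediateField.adjoin K {y} = ⊤)
    (hmin : minpoly K y = X ^ 3 + C e * X ^ 2 + C f * X + C g) :
    (3 * e * g ≠ f ^ 2 →
      ∃ (z : L) (b : K),
        IntermediateField.adjoin K {z} = ⊤ ∧
        minpoly K z = X ^ 3 + X ^ 2 + C b) ∧
    (3 * e * g = f ^ 2 →
      ∃ (z : L) (b : K),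
        IntermediateField.adjoin K {z} = ⊤ ∧
        minpoly K z = X ^ 3 - C b) := by
  have h3 : (3 : K) ≠ 0 := by
    intro h
    have hd : ringChar K ∣ 3 := ringChar.dvd (by exact_mod_cast h)
    rcases (Nat.dvd_prime Nat.prime_three).mp hd with h1 | h1
    · exact CharP.ringChar_ne_one h1
    · exact hchar h1
  have : FiniteDimensional K L := Module.finite_of_finrank_pos (by omega)
  have hy0 : y ≠ 0 := ne_zero_of_adjoin_simple_eq_top (by omega) hy
  have hg : g ≠ 0 := by
    have := (minpoly.coeff_zero_eq_zero (IsIntegral.of_finite K y)).not.mpr hy0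
    simpa [hmin] using this
  have hroot := minpoly.aeval K y
  simp only [hmin, map_add, map_mul, map_pow, aeval_X, aeval_C] at hroot
  obtain ⟨u, q, hu, hur⟩ := exists_generator_depressed_cubic h3 hdeg hy hg hroot
  have hu0 : u ≠ 0 := ne_zero_of_adjoin_simple_eq_top (by omega) hu
  set p := (3 * e * g - f ^ 2) / (3 * g ^ 2) with hp
  refine ⟨fun h => ?_, fun h => ?_⟩
  · have hp0 : p ≠ 0 := div_ne_zero (sub_ne_zero.mpr h) (by positivity)
    have hq0 : q ≠ 0 := by
      have hmu : minpoly K u = X ^ 3 + C p * X + C q :=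
        minpoly_eq_of_adjoin_simple_eq_top hu (by monicity!)
          (by rw [hdeg]; compute_degree!) (by simpa using hur)
      have := (minpoly.coeff_zero_eq_zero (IsIntegral.of_finite K u)).not.mpr hu0
      simpa [hmu] using this
    have hp' : algebraMap K L p ≠ 0 := by simpa using hp0
    have hq' : algebraMap K L q ≠ 0 := by simpa using hq0
    have hz : IntermediateField.adjoin K {algebraMap K L (q / p) * u⁻¹} = ⊤ := by
      refine adjoin_simple_eq_top_of_mem hu ?_
      set z := algebraMap K L (q / p) * u⁻¹ with hz
      have : u = algebraMap K L (q / p) * z⁻¹ := by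
        rw [hz, map_div₀]
        field_simp
      rw [this]
      exact mul_mem (IntermediateField.algebraMap_mem _ _)
        (inv_mem (IntermediateField.mem_adjoin_simple_self K z))
    refine ⟨_, q ^ 2 / p ^ 3, hz, minpoly_eq_of_adjoin_simple_eq_top hz (by monicity!)
      (by rw [hdeg]; compute_degree!) ?_⟩
    simp only [map_add, map_pow, aeval_X, aeval_C, map_div₀]
    field_simp
    linear_combination (algebraMap K L q ^ 2) * hur
  · have hp0 : p = 0 := by simp [hp, h]
    refine ⟨u, -q, hu, minpoly_eq_of_adjoin_simple_eq_top hu (by monicity!)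
      (by rw [hdeg]; compute_degree!) ?_⟩
    simpa [hp0] using hur
end

section
/- Let K be a field of characteristic different from 3, let L/K be a separable field extension of degree 3, and let y be a primitive element of L/K with minimal polynomial X^3 + eX^2 + fX + g over K (e, f, g ∈ K). (a) If 3eg ≠ f^2, then there exists a primitive element z of L/K whose minimal polynomial over K has the form X^3 − 3X − b for some b ∈ K. (b) If 3eg = f^2, then there exists a primitive element z of L/K whose minimal polynomial over K has the form X^3 − b for some b ∈ K. -/
open Polynomial

lemma minpoly_natDegree_eq_three_of_notMem_range {K L : Type*} [Field K] [Field L] [Algebra K L]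
    (hdeg : Module.finrank K L = 3) {x : L} (hx : x ∉ (algebraMap K L).range) :
    (minpoly K x).natDegree = 3 := by
  have : FiniteDimensional K L := .of_finrank_pos (by omega)
  have hdvd := minpoly.degree_dvd (Algebra.IsIntegral.isIntegral (R := K) x)
  rw [hdeg] at hdvd
  refine ((Nat.dvd_prime Nat.prime_three).1 hdvd).resolve_left fun h => hx ?_
  exact minpoly.natDegree_eq_one_iff.1 h

/-- In a cubic extension, a nonrational root of a monic cubic is primitive, with that cubic as its
minimal polynomial. -/
lemma adjoin_eq_top_and_minpoly_eq_of_cubic {K L : Type*} [Field K] [Field L] [Algebra K L]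
    [Algebra.IsSeparable K L] (hdeg : Module.finrank K L = 3) {x : L}
    (hx : x ∉ (algebraMap K L).range) {p : K[X]} (hp : p.Monic) (hp3 : p.natDegree = 3)
    (hroot : aeval x p = 0) :
    IntermediateField.adjoin K {x} = ⊤ ∧ minpoly K x = p := by
  have : FiniteDimensional K L := .of_finrank_pos (by omega)
  have h3 := minpoly_natDegree_eq_three_of_notMem_range hdeg hx
  refine ⟨(Field.primitive_element_iff_minpoly_natDegree_eq K x).2 (h3.trans hdeg.symm), ?_⟩
  exact (eq_of_monic_of_dvd_of_natDegree_le (minpoly.monic (Algebra.IsIntegral.isIntegral x)) hp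
    (minpoly.dvd K x hroot) (by omega)).symm

/-- In a cubic extension, the square of a nonrational element is nonrational. -/
lemma sq_notMem_range_of_cubic {K L : Type*} [Field K] [Field L] [Algebra K L]
    (hdeg : Module.finrank K L = 3) {x : L} (hx : x ∉ (algebraMap K L).range) :
    x ^ 2 ∉ (algebraMap K L).range := by
  rintro ⟨k, hk⟩
  have h3 := minpoly_natDegree_eq_three_of_notMem_range hdeg hx
  have hle := natDegree_le_of_dvd (minpoly.dvd K x (p := X ^ 2 - C k) (by simp [hk]))
    (X_pow_sub_C_ne_zero (by norm_num) k)
  rw [natDegree_X_pow_sub_C] at hle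
  omega

/-- Let K be a field of characteristic different from 3, let L/K be a separable field
extension of degree 3, and let y be a primitive element of L/K with minimal polynomial
X^3 + eX^2 + fX + g over K. (a) If 3eg ≠ f^2, then there exists a primitive element z of
L/K whose minimal polynomial over K has the form X^3 − 3X − b for some b ∈ K.
(b) If 3eg = f^2, then there exists a primitive element z of L/K whose minimal polynomial
over K has the form X^3 − b for some b ∈ K. -/
theorem cubic_generator_standard_forms
    (K L : Type*) [Field K] [Field L] [Algebra K L]
    (hchar : ringChar K ≠ 3)
    [Algebra.IsSeparable K L]
    (hdeg : Module.finrank K L = 3)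
    (y : L) (e f g : K)
    (hy : IntermediateField.adjoin K {y} = ⊤)
    (hmin : minpoly K y = X ^ 3 + C e * X ^ 2 + C f * X + C g) :
    (3 * e * g ≠ f ^ 2 →
      ∃ (z : L) (b : K),
        IntermediateField.adjoin K {z} = ⊤ ∧
        minpoly K z = X ^ 3 - 3 * X - C b) ∧
    (3 * e * g = f ^ 2 →
      ∃ (z : L) (b : K),
        IntermediateField.adjoin K {z} = ⊤ ∧
        minpoly K z = X ^ 3 - C b) := by
  have h3 : (3 : K) ≠ 0 := fun h => hchar <|
    CharP.ringChar_of_prime_eq_zero Nat.prime_three (by exact_mod_cast h)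
  have : FiniteDimensional K L := .of_finrank_pos (by omega)
  have hyK : y ∉ (algebraMap K L).range := fun h => by
    have h1 := minpoly.natDegree_eq_one_iff.2 h
    rw [(Field.primitive_element_iff_minpoly_natDegree_eq K y).1 hy, hdeg] at h1
    omega
  have hy0 : y ≠ 0 := by
    rintro rfl
    exact hyK (zero_mem _)
  have hg : g ≠ 0 := by
    have h := minpoly.coeff_zero_ne_zero (Algebra.IsIntegral.isIntegral (R := K) y) hy0
    simpa [hmin] using h
  have h3L : (3 : L) ≠ 0 := by
    rw [← map_ofNat (algebraMap K L) 3]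
    exact (_root_.map_ne_zero _).2 h3
  have hgL : algebraMap K L g ≠ 0 := (_root_.map_ne_zero _).2 hg
  have hroot : y ^ 3 + algebraMap K L e * y ^ 2 + algebraMap K L f * y + algebraMap K L g = 0 := by
    simpa [hmin] using minpoly.aeval K y
  obtain ⟨w, hw⟩ : ∃ w : L, w = y⁻¹ + algebraMap K L (f / (3 * g)) := ⟨_, rfl⟩
  obtain ⟨p, hp⟩ : ∃ p : K, p = (3 * e * g - f ^ 2) / (3 * g ^ 2) := ⟨_, rfl⟩
  obtain ⟨q, hq⟩ : ∃ q : K, q = 1 / g - e * f / (3 * g ^ 2) + 2 * f ^ 3 / (27 * g ^ 3) :=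
    ⟨_, rfl⟩
  have h27 : (27 : L) ≠ 0 := by
    have : (27 : L) = 3 ^ 3 := by norm_num
    rw [this]
    exact pow_ne_zero _ h3L
  have hwroot : w ^ 3 + algebraMap K L p * w + algebraMap K L q = 0 := by
    rw [hw, hp, hq]
    simp only [map_add, map_sub, map_mul, map_div₀, map_pow, map_ofNat, map_one]
    field_simp
    linear_combination 729 * algebraMap K L g ^ 2 * hroot
  have hwK : w ∉ (algebraMap K L).range := by
    rintro ⟨k, hk⟩
    refine hyK ⟨(k - f / (3 * g))⁻¹, ?_⟩
    rw [map_inv₀, map_sub, hk, hw, add_sub_cancel_right, inv_inv]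
  constructor
  · intro hne
    have hp0 : p ≠ 0 := by
      rw [hp]
      exact div_ne_zero (sub_ne_zero.2 hne) (mul_ne_zero h3 (pow_ne_zero 2 hg))
    have hpL : algebraMap K L p ≠ 0 := (_root_.map_ne_zero _).2 hp0
    refine ⟨algebraMap K L (3 / p) * w ^ 2 + 2, 2 + 27 * q ^ 2 / p ^ 3,
      adjoin_eq_top_and_minpoly_eq_of_cubic hdeg ?_ ?_ ?_ ?_⟩
    · rintro ⟨k, hk⟩
      refine sq_notMem_range_of_cubic hdeg hwK ⟨(k - 2) / (3 / p), ?_⟩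
      rw [map_div₀, map_sub, hk, map_ofNat, add_sub_cancel_right, mul_div_cancel_left₀]
      exact (_root_.map_ne_zero _).2 (div_ne_zero h3 hp0)
    · rw [← C_ofNat]
      monicity!
    · rw [← C_ofNat]
      compute_degree!
    · simp only [map_add, map_sub, map_mul, map_div₀, map_pow, map_ofNat, aeval_X, aeval_C]
      field_simp
      linear_combination
        27 * (w ^ 3 + algebraMap K L p * w - algebraMap K L q) * hwroot
  · intro heq
    have hp0 : p = 0 := by rw [hp, heq, sub_self, zero_div]
    refine ⟨w, -q, adjoin_eq_top_and_minpoly_eq_of_cubic hdeg hwK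
      (monic_X_pow_sub_C _ (by norm_num)) natDegree_X_pow_sub_C ?_⟩
    simpa [hp0] using hwroot
end

section
/- Let K be a field of characteristic 3 and let L/K be a field extension of degree 3. If L/K is separable, then there exists a primitive element z of L/K whose minimal polynomial over K has the form X^3 + X^2 + b for some b ∈ K. If L/K is not separable, then L/K is purely inseparable and there exists a primitive element z of L/K whose minimal polynomial over K has the form X^3 + b for some b ∈ K. -/
open Polynomial

theorem adjoin_simple_eq_top_of_finrank_prime {K L : Type*} [Field K] [Field L] [Algebra K L]
    (hp : (Module.finrank K L).Prime) {x : L} (hx : x ∉ (algebraMap K L).range) :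
    IntermediateField.adjoin K {x} = ⊤ := by
  have := IntermediateField.isSimpleOrder_of_finrank_prime K L hp
  refine (eq_bot_or_eq_top _).resolve_left fun h ↦ hx ?_
  exact IntermediateField.mem_bot.1 (IntermediateField.adjoin_simple_eq_bot_iff.1 h)

theorem natDegree_minpoly_of_finrank_prime {K L : Type*} [Field K] [Field L] [Algebra K L]
    (hp : (Module.finrank K L).Prime) {x : L} (hx : x ∉ (algebraMap K L).range) :
    (minpoly K x).natDegree = Module.finrank K L := by
  have : FiniteDimensional K L := .of_finrank_pos hp.pos
  exact (Field.primitive_element_iff_minpoly_natDegree_eq K x).1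
    (adjoin_simple_eq_top_of_finrank_prime hp hx)

theorem minpoly_eq_of_finrank_prime {K L : Type*} [Field K] [Field L] [Algebra K L]
    (hp : (Module.finrank K L).Prime) {x : L} (hx : x ∉ (algebraMap K L).range) {p : K[X]}
    (hmonic : p.Monic) (hdeg : p.natDegree = Module.finrank K L) (hroot : aeval x p = 0) :
    minpoly K x = p := by
  have : FiniteDimensional K L := .of_finrank_pos hp.pos
  refine (eq_of_monic_of_dvd_of_natDegree_le (minpoly.monic (.of_finite K x)) hmonic
    (minpoly.dvd K x hroot) ?_).symm
  rw [hdeg, natDegree_minpoly_of_finrank_prime hp hx]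

theorem Polynomial.Monic.eq_cubic {R : Type*} [CommRing R] {p : R[X]} (hp : p.Monic)
    (hdeg : p.natDegree = 3) :
    p = X ^ 3 + C (p.coeff 2) * X ^ 2 + C (p.coeff 1) * X + C (p.coeff 0) := by
  have h3 : p.coeff 3 = 1 := hdeg ▸ hp.coeff_natDegree
  conv_lhs => rw [p.as_sum_range_C_mul_X_pow, hdeg]
  simp only [Finset.sum_range_succ, Finset.sum_range_zero, h3, map_one]
  ring

theorem exists_minpoly_eq_X_pow_three_add_X_sq_add_C {K L : Type*} [Field K] [Field L]
    [Algebra K L] [CharP K 3] (hdeg : Module.finrank K L = 3) [Algebra.IsSeparable K L] :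
    ∃ (z : L) (b : K), IntermediateField.adjoin K {z} = ⊤ ∧
      minpoly K z = X ^ 3 + X ^ 2 + C b := by
  have hp : (Module.finrank K L).Prime := hdeg ▸ Nat.prime_three
  have : FiniteDimensional K L := .of_finrank_pos hp.pos
  have : CharP L 3 := charP_of_injective_algebraMap (algebraMap K L).injective 3
  have hK : (3 : K) = 0 := CharP.cast_eq_zero K 3
  have hL : (3 : L) = 0 := CharP.cast_eq_zero L 3
  obtain ⟨y, hy⟩ := Algebra.trace_surjective K L 1
  have hyK : y ∉ (algebraMap K L).range := by
    rintro ⟨k, rfl⟩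
    simp [Algebra.trace_algebraMap, hdeg, hK] at hy
  have hydeg := (natDegree_minpoly_of_finrank_prime hp hyK).trans hdeg
  have ha : (minpoly K y).coeff 2 ≠ 0 := by
    intro h
    rw [trace_eq_finrank_mul_minpoly_nextCoeff, nextCoeff_of_natDegree_pos (by omega), hydeg, h]
      at hy
    simp at hy
  have hroot := minpoly.aeval K y
  rw [(minpoly.monic (.of_finite K y)).eq_cubic hydeg] at hroot
  generalize (minpoly K y).coeff 2 = a at ha hroot
  generalize (minpoly K y).coeff 1 = c at hroot
  generalize (minpoly K y).coeff 0 = d at hroot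
  simp only [map_add, map_mul, map_pow, aeval_X, aeval_C] at hroot
  have haL : algebraMap K L a ≠ 0 := by simpa using ha
  let z : L := (y - algebraMap K L (c / a)) / algebraMap K L a
  let b : K := ((c / a) ^ 3 + a * (c / a) ^ 2 + c * (c / a) + d) / a ^ 3
  have hzK : z ∉ (algebraMap K L).range := by
    rintro ⟨k, hk⟩
    refine hyK ⟨k * a + c / a, ?_⟩
    rw [map_add, map_mul, hk, div_mul_cancel₀ _ haL, sub_add_cancel]
  refine ⟨z, b, adjoin_simple_eq_top_of_finrank_prime hp hzK,
    minpoly_eq_of_finrank_prime hp hzK (by monicity!) (by rw [hdeg]; compute_degree!) ?_⟩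
  simp only [map_add, map_mul, map_pow, map_div₀, aeval_X, aeval_C, z, b]
  generalize algebraMap K L a = a at *
  generalize algebraMap K L c = c at *
  generalize algebraMap K L d = d at *
  field_simp
  linear_combination a ^ 3 * hroot +
    (y * a * c ^ 2 - a ^ 3 * c * y - y ^ 2 * a ^ 2 * c + a ^ 2 * c ^ 2) * hL

theorem exists_minpoly_eq_X_pow_three_add_C {K L : Type*} [Field K] [Field L]
    [Algebra K L] [CharP K 3] (hdeg : Module.finrank K L = 3) (h : ¬ Algebra.IsSeparable K L) :
    ∃ (z : L) (b : K), IntermediateField.adjoin K {z} = ⊤ ∧ minpoly K z = X ^ 3 + C b := by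
  have hp : (Module.finrank K L).Prime := hdeg ▸ Nat.prime_three
  have : FiniteDimensional K L := .of_finrank_pos hp.pos
  obtain ⟨z, hz⟩ : ∃ z : L, ¬ IsSeparable K z := by
    simpa [Algebra.isSeparable_def] using h
  have hzK : z ∉ (algebraMap K L).range := by
    rintro ⟨k, rfl⟩
    exact hz (isSeparable_algebraMap k)
  have hzdeg := (natDegree_minpoly_of_finrank_prime hp hzK).trans hdeg
  have hcubic := (minpoly.monic (.of_finite K z)).eq_cubic hzdeg
  have hder : derivative (minpoly K z) = 0 := by
    by_contra h0
    exact hz ((separable_iff_derivative_ne_zero (minpoly.irreducible (.of_finite K z))).2 h0)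
  have h1 : (minpoly K z).coeff 1 = 0 := by
    simpa [coeff_derivative] using congr_arg (coeff · 0) hder
  have h2 : (minpoly K z).coeff 2 = 0 := by
    have h2' : (minpoly K z).coeff 2 * (1 + 1) = 0 := by
      simpa [coeff_derivative] using congr_arg (coeff · 1) hder
    have hK : (3 : K) = 0 := CharP.cast_eq_zero K 3
    linear_combination (minpoly K z).coeff 2 * hK - h2'
  refine ⟨z, (minpoly K z).coeff 0, adjoin_simple_eq_top_of_finrank_prime hp hzK, ?_⟩
  simpa [h1, h2] using hcubic

/-- Let K be a field of characteristic 3 and let L/K be a field extension of degree 3.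
If L/K is separable, then there exists a primitive element z of L/K whose minimal
polynomial over K has the form X^3 + X^2 + b for some b ∈ K. If L/K is not separable,
then L/K is purely inseparable and there exists a primitive element z of L/K whose
minimal polynomial over K has the form X^3 + b for some b ∈ K. -/
theorem char_three_cubic_generator
    (K L : Type*) [Field K] [Field L] [Algebra K L]
    [CharP K 3]
    (hdeg : Module.finrank K L = 3) :
    (Algebra.IsSeparable K L →
      ∃ (z : L) (b : K),
        IntermediateField.adjoin K {z} = ⊤ ∧
        minpoly K z = X ^ 3 + X ^ 2 + C b) ∧
    (¬ Algebra.IsSeparable K L →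
      IsPurelyInseparable K L ∧
      ∃ (z : L) (b : K),
        IntermediateField.adjoin K {z} = ⊤ ∧
        minpoly K z = X ^ 3 + C b) := by
  refine ⟨fun _ ↦ exists_minpoly_eq_X_pow_three_add_X_sq_add_C hdeg, fun h ↦ ?_⟩
  obtain ⟨z, b, hz, hb⟩ := exists_minpoly_eq_X_pow_three_add_C hdeg h
  refine ⟨?_, z, b, hz, hb⟩
  have : ExpChar K 3 := .prime Nat.prime_three
  rw [isPurelyInseparable_iff_perfectClosure_eq_top, ← top_le_iff, ← hz,
    IntermediateField.adjoin_simple_le_iff, mem_perfectClosure_iff_pow_mem 3]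
  have hroot := minpoly.aeval K z
  simp only [hb, map_add, map_pow, aeval_X, aeval_C] at hroot
  exact ⟨1, -b, by rw [map_neg, pow_one, eq_neg_of_add_eq_zero_left hroot]⟩
end

section
/- Let K be a field of characteristic 3 and let L/K be a separable field extension of degree 3. Then there exists a primitive element z of L/K whose minimal polynomial over K has the form X^3 + bX + b^2 for some b ∈ K. -/
open Polynomial

section CubicExtension

variable {K L : Type*} [Field K] [Field L] [Algebra K L]

theorem natDegree_minpoly_eq_three (hdeg : Module.finrank K L = 3) {z : L}
    (hz : z ∉ Set.range (algebraMap K L)) : (minpoly K z).natDegree = 3 := by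
  have : FiniteDimensional K L := Module.finite_of_finrank_pos (by omega)
  have hdvd : (minpoly K z).natDegree ∣ 3 :=
    hdeg ▸ minpoly.degree_dvd (Algebra.IsIntegral.isIntegral z)
  rcases (Nat.dvd_prime Nat.prime_three).1 hdvd with h | h
  · exact absurd (minpoly.natDegree_eq_one_iff.1 h) hz
  · exact h

theorem adjoin_eq_top_of_finrank_eq_three (hdeg : Module.finrank K L = 3) {z : L}
    (hz : z ∉ Set.range (algebraMap K L)) : IntermediateField.adjoin K {z} = ⊤ := by
  have : FiniteDimensional K L := Module.finite_of_finrank_pos (by omega)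
  rw [Field.primitive_element_iff_minpoly_natDegree_eq, natDegree_minpoly_eq_three hdeg hz, hdeg]

theorem minpoly_eq_depressed_cubic (hdeg : Module.finrank K L = 3) {z : L}
    (hz : z ∉ Set.range (algebraMap K L)) {p q : K}
    (h : z ^ 3 + algebraMap K L p * z + algebraMap K L q = 0) :
    minpoly K z = X ^ 3 + C p * X + C q := by
  have : FiniteDimensional K L := Module.finite_of_finrank_pos (by omega)
  have hmonic : (X ^ 3 + C p * X + C q : K[X]).Monic := by monicity!
  have hnat : (X ^ 3 + C p * X + C q : K[X]).natDegree = 3 := by compute_degree!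
  refine (eq_of_monic_of_dvd_of_natDegree_le
    (minpoly.monic (Algebra.IsIntegral.isIntegral z)) hmonic
    (minpoly.dvd K z (by simpa using h)) ?_).symm
  rw [hnat, natDegree_minpoly_eq_three hdeg hz]

theorem exists_cubic_relation (hdeg : Module.finrank K L = 3) {y : L}
    (hy : y ∉ Set.range (algebraMap K L)) :
    ∃ a b c : K, y ^ 3 + algebraMap K L a * y ^ 2 + algebraMap K L b * y
      + algebraMap K L c = 0 := by
  have : FiniteDimensional K L := Module.finite_of_finrank_pos (by omega)
  have hnat := natDegree_minpoly_eq_three hdeg hy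
  have hlead : (minpoly K y).coeff 3 = 1 := by
    simpa [hnat] using (minpoly.monic (Algebra.IsIntegral.isIntegral (R := K) y)).coeff_natDegree
  refine ⟨(minpoly K y).coeff 2, (minpoly K y).coeff 1, (minpoly K y).coeff 0, ?_⟩
  have h := minpoly.aeval K y
  rw [aeval_eq_sum_range, hnat] at h
  simp only [Finset.sum_range_succ, Finset.sum_range_zero, Algebra.smul_def, hlead, map_one] at h
  linear_combination h

/-- A separable cubic extension in characteristic 3 is generated by a root of a cubic with no
quadratic term and nonzero linear and constant terms. -/
theorem exists_depressed_cubic_relation [CharP K 3] [Algebra.IsSeparable K L]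
    (hdeg : Module.finrank K L = 3) :
    ∃ (y : L) (p q : K), y ∉ Set.range (algebraMap K L) ∧ p ≠ 0 ∧ q ≠ 0 ∧
      y ^ 3 + algebraMap K L p * y + algebraMap K L q = 0 := by
  have : FiniteDimensional K L := Module.finite_of_finrank_pos (by omega)
  have hK : (3 : K) = 0 := by exact_mod_cast CharP.cast_eq_zero K 3
  have hL : (3 : L) = 0 := by rw [← map_ofNat (algebraMap K L) 3, hK, map_zero]
  obtain ⟨y, hy⟩ : ∃ y : L, y ∉ Set.range (algebraMap K L) := by
    by_contra! hall
    have hbot : (⊥ : Subalgebra K L) = ⊤ :=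
      eq_top_iff.2 fun x _ => Algebra.mem_bot.2 (hall x)
    have := Subalgebra.bot_eq_top_iff_finrank_eq_one.1 hbot
    omega
  obtain ⟨a, b, c, h⟩ := exists_cubic_relation hdeg hy
  rcases eq_or_ne a 0 with rfl | ha
  · have h' : y ^ 3 + algebraMap K L b * y + algebraMap K L c = 0 := by simpa using h
    have hmin := minpoly_eq_depressed_cubic hdeg hy h'
    refine ⟨y, b, c, hy, ?_, ?_, h'⟩
    · rintro rfl
      have hsep := Algebra.IsSeparable.isSeparable K y
      rw [IsSeparable, hmin] at hsep
      have hder : derivative (X ^ 3 + C 0 * X + C c : K[X]) = 0 := by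
        simp only [C_0, zero_mul, add_zero, derivative_add, derivative_X_pow, derivative_C]
        rw [Nat.cast_ofNat, hK, C_0, zero_mul]
      rw [Polynomial.Separable, hder, isCoprime_zero_right, ← hmin] at hsep
      exact minpoly.not_isUnit K y hsep
    · rintro rfl
      have hy0 : y ≠ 0 := by
        rintro rfl
        exact hy ⟨0, map_zero _⟩
      refine minpoly.coeff_zero_ne_zero (Algebra.IsIntegral.isIntegral (R := K) y) hy0 ?_
      rw [hmin]
      simp
  · set s : K := b / a
    have hs : algebraMap K L a * algebraMap K L s = algebraMap K L b := by
      rw [← map_mul, mul_div_cancel₀ _ ha]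
    set u : L := y - algebraMap K L s
    have hu : u ∉ Set.range (algebraMap K L) := by
      rintro ⟨k, hk⟩
      exact hy ⟨k + s, by rw [map_add, hk]; simp [u]⟩
    have hu0 : u ≠ 0 := fun h0 => hu ⟨0, by rw [map_zero, h0]⟩
    set d : K := s ^ 3 + a * s ^ 2 + b * s + c
    have hrel : u ^ 3 + algebraMap K L a * u ^ 2 + algebraMap K L d = 0 := by
      simp only [u, d, map_add, map_mul, map_pow]
      linear_combination h - (y - algebraMap K L s) * hs * 2
        + (-(y ^ 2 * algebraMap K L s) + y * algebraMap K L s ^ 2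
          - (y - algebraMap K L s) * algebraMap K L b) * hL
    have hd : d ≠ 0 := by
      intro h0
      rw [h0, map_zero] at hrel
      have : u = -algebraMap K L a := by
        apply mul_left_cancel₀ (pow_ne_zero 2 hu0)
        linear_combination hrel
      exact hu ⟨-a, by rw [map_neg, this]⟩
    have hdL : algebraMap K L d ≠ 0 := by simpa using hd
    refine ⟨u⁻¹, a / d, 1 / d, ?_, div_ne_zero ha hd, one_div_ne_zero hd, ?_⟩
    · rintro ⟨k, hk⟩
      exact hu ⟨k⁻¹, by rw [map_inv₀, hk, inv_inv]⟩
    · rw [map_div₀, map_div₀, map_one]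
      field_simp
      linear_combination hrel

end CubicExtension

/-- Let K be a field of characteristic 3 and let L/K be a separable field extension of
degree 3. Then there exists a primitive element z of L/K whose minimal polynomial over K
has the form X^3 + bX + b^2 for some b ∈ K. -/
theorem char_three_separable_cubic_generator
    (K L : Type*) [Field K] [Field L] [Algebra K L]
    [CharP K 3]
    [Algebra.IsSeparable K L]
    (hdeg : Module.finrank K L = 3) :
    ∃ (z : L) (b : K),
      IntermediateField.adjoin K {z} = ⊤ ∧
      minpoly K z = X ^ 3 + C b * X + C (b ^ 2) := by
  obtain ⟨y, p, q, hy, hp, hq, h⟩ := exists_depressed_cubic_relation (K := K) (L := L) hdeg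
  set t : K := q / p ^ 2
  have ht : t ≠ 0 := div_ne_zero hq (pow_ne_zero 2 hp)
  have hz : algebraMap K L t * y ∉ Set.range (algebraMap K L) := by
    rintro ⟨k, hk⟩
    refine hy ⟨k / t, ?_⟩
    rw [map_div₀, hk, mul_div_cancel_left₀ _ (by simpa using ht)]
  have htq : algebraMap K L t * algebraMap K L p ^ 2 = algebraMap K L q := by
    rw [← map_pow, ← map_mul, div_mul_cancel₀ _ (pow_ne_zero 2 hp)]
  refine ⟨algebraMap K L t * y, t ^ 2 * p, adjoin_eq_top_of_finrank_eq_three hdeg hz,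
    minpoly_eq_depressed_cubic hdeg hz ?_⟩
  simp only [map_mul, map_pow]
  linear_combination algebraMap K L t ^ 3 * h + algebraMap K L t ^ 3 * htq
end

section
/- Let K be a field of characteristic 3 and let L/K be a Galois field extension of degree 3. Then there exists a primitive element z of L/K and an element a ∈ K such that the minimal polynomial of z over K is X^3 − X − a (equivalently, z^3 − z = a). -/
open Polynomial

section AdditiveHilbert

variable {K L : Type*} [Field K] [Field L] [Algebra K L]

/-- In a Galois cubic extension, some automorphism `σ` and its powers `1, σ, σ ^ 2` form the whole
Galois group, so they compute the trace. -/
theorem exists_algEquiv_trace_eq_of_finrank_eq_three [IsGalois K L]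
    (hdeg : Module.finrank K L = 3) :
    ∃ σ : L ≃ₐ[K] L, (∀ x, σ (σ (σ x)) = x) ∧ (∀ τ : L ≃ₐ[K] L, τ ∈ Subgroup.zpowers σ) ∧
      ∀ x, algebraMap K L (Algebra.trace K L x) = x + σ x + σ (σ x) := by
  classical
  have : FiniteDimensional K L := Module.finite_of_finrank_pos (by omega)
  have hcard : Nat.card (L ≃ₐ[K] L) = 3 := by rw [IsGalois.card_aut_eq_finrank, hdeg]
  have : IsCyclic (L ≃ₐ[K] L) := isCyclic_of_prime_card (p := 3) hcard
  obtain ⟨σ, hσ⟩ := IsCyclic.exists_generator (α := L ≃ₐ[K] L)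
  have hord : orderOf σ = 3 := (orderOf_eq_card_of_forall_mem_zpowers hσ).trans hcard
  have h3 : σ ^ 3 = 1 := hord ▸ pow_orderOf_eq_one σ
  refine ⟨σ, fun x ↦ by simpa [pow_succ] using DFunLike.congr_fun h3 x, hσ, fun x ↦ ?_⟩
  have huniv : (Finset.range 3).image (σ ^ ·) = (Finset.univ : Finset (L ≃ₐ[K] L)) := by
    apply Finset.eq_univ_of_card
    rw [Finset.card_image_of_injOn, Finset.card_range, ← Nat.card_eq_fintype_card, hcard]
    simpa [hord] using pow_injOn_Iio_orderOf (x := σ)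
  rw [trace_eq_sum_automorphisms, ← huniv, Finset.sum_image]
  · simp [Finset.sum_range_succ]
  · simpa [hord] using pow_injOn_Iio_orderOf (x := σ)

/-- In characteristic three, a Galois cubic extension has a generator of its Galois group that
translates some element by `1`. -/
theorem exists_algEquiv_apply_eq_add_one_of_finrank_eq_three [CharP K 3] [IsGalois K L]
    (hdeg : Module.finrank K L = 3) :
    ∃ (σ : L ≃ₐ[K] L) (z : L), (∀ τ : L ≃ₐ[K] L, τ ∈ Subgroup.zpowers σ) ∧ σ z = z + 1 := by
  have : FiniteDimensional K L := Module.finite_of_finrank_pos (by omega)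
  have : CharP L 3 := charP_of_injective_algebraMap (algebraMap K L).injective 3
  have h3 : (3 : L) = 0 := by exact_mod_cast CharP.cast_eq_zero L 3
  obtain ⟨σ, hσ3, hσ, htr⟩ := exists_algEquiv_trace_eq_of_finrank_eq_three hdeg
  obtain ⟨t, ht⟩ := Algebra.trace_surjective K L 1
  have h1 := htr t
  rw [ht, map_one] at h1
  refine ⟨σ, σ (σ t) - σ t, hσ, ?_⟩
  rw [map_sub, hσ3]
  linear_combination -h1 - σ (σ t) * h3

end AdditiveHilbert

/-- Let K be a field of characteristic 3 and let L/K be a Galois field extension of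
degree 3. Then there exists a primitive element z of L/K and an element a ∈ K such that
the minimal polynomial of z over K is X^3 − X − a (equivalently, z^3 − z = a). -/
theorem char_three_galois_cubic_is_artin_schreier
    (K L : Type*) [Field K] [Field L] [Algebra K L]
    [CharP K 3]
    [IsGalois K L]
    (hdeg : Module.finrank K L = 3) :
    ∃ (z : L) (a : K),
      IntermediateField.adjoin K {z} = ⊤ ∧
      minpoly K z = X ^ 3 - X - C a := by
  have : FiniteDimensional K L := Module.finite_of_finrank_pos (by omega)
  have : CharP L 3 := charP_of_injective_algebraMap (algebraMap K L).injective 3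
  have h3 : (3 : L) = 0 := by exact_mod_cast CharP.cast_eq_zero L 3
  obtain ⟨σ, z, hσ, hz⟩ := exists_algEquiv_apply_eq_add_one_of_finrank_eq_three (K := K) hdeg
  have hfix : σ (z ^ 3 - z) = z ^ 3 - z := by
    rw [map_sub, map_pow, hz]
    linear_combination (z ^ 2 + z) * h3
  obtain ⟨a, ha⟩ : z ^ 3 - z ∈ Set.range (algebraMap K L) := by
    refine IsGalois.mem_range_algebraMap_iff_fixed _ |>.2 fun τ ↦ ?_
    have hle : Subgroup.zpowers σ ≤ MulAction.stabilizer (L ≃ₐ[K] L) (z ^ 3 - z) := by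
      rwa [Subgroup.zpowers_le]
    exact hle (hσ τ)
  have hnat : (minpoly K z).natDegree = 3 := by
    have hdvd : (minpoly K z).natDegree ∣ 3 :=
      hdeg ▸ minpoly.degree_dvd (Algebra.IsIntegral.isIntegral z)
    refine ((Nat.dvd_prime Nat.prime_three).1 hdvd).resolve_left fun h ↦ ?_
    obtain ⟨b, rfl⟩ := minpoly.natDegree_eq_one_iff.1 h
    simp at hz
  refine ⟨z, a, ?_, ?_⟩
  · rw [Field.primitive_element_iff_minpoly_natDegree_eq, hnat, hdeg]
  · have hdeg3 : (X ^ 3 - X - C a).natDegree = 3 := by compute_degree!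
    have hmonic : (X ^ 3 - X - C a).Monic := by monicity!
    refine (eq_of_monic_of_dvd_of_natDegree_le (minpoly.monic (Algebra.IsIntegral.isIntegral z))
      hmonic (minpoly.dvd K z ?_) (by rw [hdeg3, hnat])).symm
    simp [ha]
end

section
/- Let K be a field whose characteristic is neither 2 nor 3, and let L/K be a field extension of degree 3 admitting a primitive element y with minimal polynomial X^3 − 3X − a over K for some a ∈ K. Then L/K is purely cubic if and only if a^2 − 4 is a square in K. -/
open Polynomial

/-- In a cubic extension `L = K(w)`, the elements `1, w, w ^ 2` are linearly independent. -/
theorem eq_zero_of_quadratic_relation {K L : Type*} [Field K] [Field L] [Algebra K L]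
    (hdeg : Module.finrank K L = 3) {w : L} (hw : IntermediateField.adjoin K {w} = ⊤)
    {p q r : K} (h : algebraMap K L p + algebraMap K L q * w + algebraMap K L r * w ^ 2 = 0) :
    p = 0 ∧ q = 0 ∧ r = 0 := by
  have : FiniteDimensional K L := .of_finrank_pos (by lia)
  have hint : IsIntegral K w := .of_finite K w
  have hd : (minpoly K w).natDegree = 3 := by
    rw [← IntermediateField.adjoin.finrank hint, hw, IntermediateField.finrank_top', hdeg]
  have hf : C r * X ^ 2 + C q * X + C p = 0 := by
    by_contra hne
    have hroot : aeval w (C r * X ^ 2 + C q * X + C p) = 0 := by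
      simp only [map_add, map_mul, map_pow, aeval_C, aeval_X]
      linear_combination h
    have hle := natDegree_le_natDegree (minpoly.degree_le_of_ne_zero K w hne hroot)
    have := natDegree_quadratic_le (a := r) (b := q) (c := p)
    lia
  refine ⟨?_, ?_, ?_⟩
  · simpa using congr_arg (coeff · 0) hf
  · simpa using congr_arg (coeff · 1) hf
  · simpa [coeff_X, coeff_C] using congr_arg (coeff · 2) hf

/-- In a cubic extension `L = K(w)`, the elements `1, w, w ^ 2` span. -/
theorem exists_quadratic_expression {K L : Type*} [Field K] [Field L] [Algebra K L]
    (hdeg : Module.finrank K L = 3) {w : L} (hw : IntermediateField.adjoin K {w} = ⊤) (y : L) :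
    ∃ p q r : K,
      y = algebraMap K L p + algebraMap K L q * w + algebraMap K L r * w ^ 2 := by
  have : FiniteDimensional K L := .of_finrank_pos (by lia)
  have hint : IsIntegral K w := .of_finite K w
  have hd : (minpoly K w).natDegree = 3 := by
    rw [← IntermediateField.adjoin.finrank hint, hw, IntermediateField.finrank_top', hdeg]
  have hy : y ∈ Algebra.adjoin K {w} := by
    rw [← IntermediateField.adjoin_simple_toSubalgebra_of_isAlgebraic hint.isAlgebraic, hw]
    exact IntermediateField.mem_top
  obtain ⟨g, rfl⟩ := Algebra.adjoin_mem_exists_aeval K w hy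
  have hf := natDegree_modByMonic_lt g (minpoly.monic hint) (minpoly.ne_one K w)
  rw [← aeval_modByMonic_eq_self_of_root (minpoly.aeval K w)]
  set f := g %ₘ minpoly K w
  rw [hd] at hf
  refine ⟨f.coeff 0, f.coeff 1, f.coeff 2, ?_⟩
  rw [aeval_eq_sum_range' hf]
  simp [Finset.sum_range_succ, Algebra.smul_def]

/-- If `L = K(w)` is cubic and `w ^ 3 = c` with `c` in `K`, then `c` is not a cube in `K`. -/
theorem not_cube_of_adjoin_eq_top {K L : Type*} [Field K] [Field L] [Algebra K L]
    (hdeg : Module.finrank K L = 3) {w : L} (hw : IntermediateField.adjoin K {w} = ⊤)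
    {c : K} (hc : w ^ 3 = algebraMap K L c) (e : K) : c ≠ e ^ 3 := by
  rintro rfl
  rw [map_pow] at hc
  have hprod : (algebraMap K L (-e) + algebraMap K L 1 * w + algebraMap K L 0 * w ^ 2) *
      (algebraMap K L (e ^ 2) + algebraMap K L e * w + algebraMap K L 1 * w ^ 2) = 0 := by
    simp only [map_neg, map_pow, map_one, map_zero]
    linear_combination hc
  rcases mul_eq_zero.1 hprod with h | h
  · exact one_ne_zero (eq_zero_of_quadratic_relation hdeg hw h).2.1
  · exact one_ne_zero (eq_zero_of_quadratic_relation hdeg hw h).2.2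

/-- In a cubic extension, every element outside the base field is primitive. -/
theorem adjoin_eq_top_of_finrank_eq_three_s6 {K L : Type*} [Field K] [Field L] [Algebra K L]
    (hdeg : Module.finrank K L = 3) {w : L} (hw : ∀ e : K, algebraMap K L e ≠ w) :
    IntermediateField.adjoin K {w} = ⊤ := by
  have : FiniteDimensional K L := .of_finrank_pos (by lia)
  have hmul := Module.finrank_mul_finrank K (IntermediateField.adjoin K {w}) L
  rw [hdeg] at hmul
  rcases (Nat.dvd_prime Nat.prime_three).1 ⟨_, hmul.symm⟩ with h | h
  · rw [IntermediateField.finrank_adjoin_simple_eq_one_iff, IntermediateField.mem_bot] at h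
    exact absurd h.choose_spec (hw _)
  · exact IntermediateField.eq_of_le_of_finrank_eq le_top
      (by rw [h, IntermediateField.finrank_top', hdeg])

/-- Let K be a field whose characteristic is neither 2 nor 3, and let L/K be a field
extension of degree 3 admitting a primitive element y with minimal polynomial
X^3 − 3X − a over K. Then L/K is purely cubic (i.e. there is a primitive element w of
L/K with w^3 ∈ K) if and only if a^2 − 4 is a square in K. -/
theorem purely_cubic_iff_discriminant_square
    (K L : Type*) [Field K] [Field L] [Algebra K L]
    (h2 : ringChar K ≠ 2) (h3 : ringChar K ≠ 3)
    (hdeg : Module.finrank K L = 3)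
    (y : L) (a : K)
    (hy : IntermediateField.adjoin K {y} = ⊤)
    (hmin : minpoly K y = X ^ 3 - 3 * X - C a) :
    (∃ (w : L) (c : K),
        IntermediateField.adjoin K {w} = ⊤ ∧ w ^ 3 = algebraMap K L c)
      ↔ IsSquare (a ^ 2 - 4) := by
  have two_ne : (2 : K) ≠ 0 := Ring.two_ne_zero h2
  have three_ne : (3 : K) ≠ 0 := by
    intro h
    have hdvd : ringChar K ∣ 3 := ringChar.dvd (by exact_mod_cast h)
    rcases (Nat.dvd_prime Nat.prime_three).1 hdvd with h1 | h1
    · exact CharP.ringChar_ne_one h1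
    · exact h3 h1
  have hroot : y ^ 3 - 3 * y - algebraMap K L a = 0 := by
    have := minpoly.aeval K y
    rw [hmin] at this
    simpa only [map_sub, map_mul, map_pow, map_ofNat, aeval_X, aeval_C] using this
  constructor
  · rintro ⟨w, c, hw, hc⟩
    obtain ⟨p, q, r, rfl⟩ := exists_quadratic_expression hdeg hw y
    have hrel : algebraMap K L (p ^ 3 + 6 * p * q * r * c + q ^ 3 * c + r ^ 3 * c ^ 2 - 3 * p - a)
        + algebraMap K L (3 * (p ^ 2 * q + p * r ^ 2 * c + q ^ 2 * r * c - q)) * w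
        + algebraMap K L (3 * (p ^ 2 * r + p * q ^ 2 + q * r ^ 2 * c - r)) * w ^ 2 = 0 := by
      simp only [map_add, map_sub, map_mul, map_pow, map_ofNat, ← hc]
      linear_combination hroot
    obtain ⟨e0, e1, e2⟩ := eq_zero_of_quadratic_relation hdeg hw hrel
    replace e1 := (mul_eq_zero.1 e1).resolve_left three_ne
    replace e2 := (mul_eq_zero.1 e2).resolve_left three_ne
    have hqr : ¬ (q = 0 ∧ r = 0) := by
      rintro ⟨rfl, rfl⟩
      have h : algebraMap K L (-p) + algebraMap K L 1 *
          (algebraMap K L p + algebraMap K L 0 * w + algebraMap K L 0 * w ^ 2) + algebraMap K L 0 *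
          (algebraMap K L p + algebraMap K L 0 * w + algebraMap K L 0 * w ^ 2) ^ 2 = 0 := by
        simp
      exact one_ne_zero (eq_zero_of_quadratic_relation hdeg hy h).2.1
    have hcube : r ^ 3 * c ≠ q ^ 3 := by
      intro h
      by_cases hr : r = 0
      · subst hr
        exact hqr ⟨by simpa using h.symm, rfl⟩
      · refine not_cube_of_adjoin_eq_top hdeg hw hc (q / r) ?_
        field_simp
        linear_combination h
    have hp : p = 0 := by
      have h : p * (r ^ 3 * c - q ^ 3) = 0 := by linear_combination r * e1 - q * e2
      exact (mul_eq_zero.1 h).resolve_right (sub_ne_zero.2 hcube)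
    subst hp
    have hone : q * r * c = 1 := by
      by_cases hq : q = 0
      · have hr : r ≠ 0 := fun hr ↦ hqr ⟨hq, hr⟩
        apply mul_left_cancel₀ hr
        linear_combination e2
      · apply mul_left_cancel₀ hq
        linear_combination e1
    have ha : a = q ^ 3 * c + r ^ 3 * c ^ 2 := by linear_combination -e0
    refine ⟨q ^ 3 * c - r ^ 3 * c ^ 2, ?_⟩
    rw [ha]
    linear_combination 4 * ((q * r * c) ^ 2 + q * r * c + 1) * hone
  · rintro ⟨b, hb⟩
    have hb0 : b ≠ 0 := by
      rintro rfl
      have hprod : (algebraMap K L (-a) + algebraMap K L 1 * y + algebraMap K L 0 * y ^ 2) *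
          (algebraMap K L (a ^ 2 - 3) + algebraMap K L a * y + algebraMap K L 1 * y ^ 2)
          = 0 := by
        have hb' := congr_arg (algebraMap K L) hb
        simp only [map_sub, map_neg, map_mul, map_pow, map_one, map_zero, map_ofNat] at hb' ⊢
        linear_combination hroot - algebraMap K L a * hb'
      rcases mul_eq_zero.1 hprod with h | h
      · exact one_ne_zero (eq_zero_of_quadratic_relation hdeg hy h).2.1
      · exact one_ne_zero (eq_zero_of_quadratic_relation hdeg hy h).2.2
    obtain ⟨u, hu⟩ : ∃ u : K, 2 * u = a + b := ⟨(a + b) / 2, by field_simp⟩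
    have hb' : b = 2 * u - a := by linear_combination -hu
    have hu1 : u * (a - u) = 1 := by
      apply mul_left_cancel₀ (mul_ne_zero two_ne two_ne)
      rw [hb'] at hb
      linear_combination hb
    refine ⟨y ^ 2 - 2 - algebraMap K L u * y, -(b ^ 3 * u), ?_, ?_⟩
    · refine adjoin_eq_top_of_finrank_eq_three_s6 hdeg fun e he ↦ ?_
      have h : algebraMap K L (-2 - e) + algebraMap K L (-u) * y + algebraMap K L 1 * y ^ 2
          = 0 := by
        simp only [map_sub, map_neg, map_one, map_ofNat]
        linear_combination -he
      exact one_ne_zero (eq_zero_of_quadratic_relation hdeg hy h).2.2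
    · have hu1' := congr_arg (algebraMap K L) hu1
      simp only [hb', map_sub, map_neg, map_mul, map_pow, map_one, map_ofNat] at hu1' ⊢
      set U := algebraMap K L u
      set A := algebraMap K L a
      have hsq : (y ^ 2 - 2 - U * y) ^ 2 = (A - 2 * U) * (-U * y ^ 2 + y + 2 * U) := by
        linear_combination (y - 2 * U) * hroot + (y ^ 2 - 4) * hu1'
      have hmul : (y ^ 2 - 2 - U * y) * (-U * y ^ 2 + y + 2 * U) = (A - 2 * U) ^ 2 * U := by
        linear_combination (-U * y + 1 + U ^ 2) * hroot + (-y - A + 4 * U) * hu1'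
      linear_combination (y ^ 2 - 2 - U * y) * hsq + (A - 2 * U) * hmul
end

section
/- Let K be a field of characteristic 2 and let L/K be a field extension of degree 3 with a primitive element y whose minimal polynomial over K is X^3 − 3X − a for some a ∈ K (note a ≠ 0 since this polynomial is irreducible). Then L/K is purely cubic if and only if the polynomial X^2 − X − 1/a^2 has a root in K. -/
open Polynomial

section CubicExtension

variable {K L : Type*} [Field K] [Field L] [Algebra K L]

theorem natDegree_minpoly_of_adjoin_eq_top (hdeg : Module.finrank K L = 3) {w : L}
    (hw : IntermediateField.adjoin K {w} = ⊤) : (minpoly K w).natDegree = 3 := by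
  have : FiniteDimensional K L := .of_finrank_pos (by omega)
  rw [← IntermediateField.adjoin.finrank (Algebra.IsIntegral.isIntegral w), hw,
    IntermediateField.finrank_top', hdeg]

theorem coeffs_eq_zero_of_quadratic_relation (hdeg : Module.finrank K L = 3) {w : L}
    (hw : IntermediateField.adjoin K {w} = ⊤) {α β γ : K}
    (h : algebraMap K L α * w ^ 2 + algebraMap K L β * w + algebraMap K L γ = 0) :
    α = 0 ∧ β = 0 ∧ γ = 0 := by
  have hp : C α * X ^ 2 + C β * X + C γ = 0 := by
    by_contra hp
    have hle := natDegree_le_of_dvd (minpoly.dvd K w (p := C α * X ^ 2 + C β * X + C γ)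
      (by simpa using h)) hp
    rw [natDegree_minpoly_of_adjoin_eq_top hdeg hw] at hle
    have := natDegree_quadratic_le (a := α) (b := β) (c := γ)
    omega
  refine ⟨?_, ?_, ?_⟩
  · simpa [coeff_X, coeff_C] using congr_arg (coeff · 2) hp
  · simpa [coeff_X, coeff_C] using congr_arg (coeff · 1) hp
  · simpa [coeff_X, coeff_C] using congr_arg (coeff · 0) hp

theorem exists_eq_quadratic (hdeg : Module.finrank K L = 3) {y : L}
    (hy : IntermediateField.adjoin K {y} = ⊤) (w : L) :
    ∃ u v t : K, w = algebraMap K L u + algebraMap K L v * y + algebraMap K L t * y ^ 2 := by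
  have : FiniteDimensional K L := .of_finrank_pos (by omega)
  have hint : IsIntegral K y := Algebra.IsIntegral.isIntegral y
  have hmem : w ∈ Algebra.adjoin K {y} := by
    rw [← IntermediateField.adjoin_simple_toSubalgebra_of_isAlgebraic hint.isAlgebraic, hy]
    trivial
  rw [Algebra.adjoin_singleton_eq_range_aeval] at hmem
  obtain ⟨p, rfl⟩ := hmem
  have hlt : (p %ₘ minpoly K y).natDegree < 3 := by
    rw [← natDegree_minpoly_of_adjoin_eq_top hdeg hy]
    exact natDegree_modByMonic_lt _ (minpoly.monic hint) (minpoly.ne_one K y)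
  refine ⟨(p %ₘ minpoly K y).coeff 0, (p %ₘ minpoly K y).coeff 1,
    (p %ₘ minpoly K y).coeff 2, ?_⟩
  have haeval : aeval y (p %ₘ minpoly K y) = aeval y p :=
    aeval_modByMonic_eq_self_of_root (minpoly.aeval K y)
  change aeval y p = _
  rw [← haeval, aeval_eq_sum_range' hlt]
  simp [Finset.sum_range_succ, Algebra.smul_def]

theorem adjoin_eq_top_of_notMem_range (hdeg : Module.finrank K L = 3) {w : L}
    (hw : ∀ k : K, algebraMap K L k ≠ w) : IntermediateField.adjoin K {w} = ⊤ := by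
  have := IntermediateField.isSimpleOrder_of_finrank_prime K L (hdeg ▸ Nat.prime_three)
  refine (eq_bot_or_eq_top (IntermediateField.adjoin K {w})).resolve_left fun hbot => ?_
  rw [IntermediateField.adjoin_simple_eq_bot_iff, IntermediateField.mem_bot] at hbot
  obtain ⟨k, hk⟩ := hbot
  exact hw k hk

end CubicExtension

/-- In characteristic two, the element `v y + t y ^ 2` with `y ^ 3 = y + a` is a root of its
depressed characteristic polynomial. -/
theorem cube_eq_of_cube_eq_add {R : Type*} [CommRing R] [CharP R 2] {y a : R}
    (hy : y ^ 3 = y + a) (v t : R) :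
    (v * y + t * y ^ 2) ^ 3 = (v ^ 2 + a * v * t + t ^ 2) * (v * y + t * y ^ 2)
      + a * (v ^ 3 + v * t ^ 2 + a * t ^ 3) := by
  have h2 : (2 : R) = 0 := CharTwo.two_eq_zero
  linear_combination (v ^ 3 + 3 * v ^ 2 * t * y + 3 * v * t ^ 2 * (y ^ 2 + 1)
      + t ^ 3 * (y ^ 3 + y + a)) * hy
    + (v ^ 2 * t * a * y + v * t ^ 2 * y + a * t ^ 3 * y + v ^ 2 * t * y ^ 2
      + v * t ^ 2 * a * y ^ 2 + a * v * t ^ 2) * h2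

/-- Let K be a field of characteristic 2 and let L/K be a field extension of degree 3
with a primitive element y whose minimal polynomial over K is X^3 − 3X − a (note a ≠ 0
since this polynomial is irreducible). Then L/K is purely cubic if and only if the
polynomial X^2 − X − 1/a^2 has a root in K. -/
theorem char_two_purely_cubic_criterion
    (K L : Type*) [Field K] [Field L] [Algebra K L]
    [CharP K 2]
    (hdeg : Module.finrank K L = 3)
    (y : L) (a : K)
    (hy : IntermediateField.adjoin K {y} = ⊤)
    (hmin : minpoly K y = X ^ 3 - 3 * X - C a) :
    (∃ (w : L) (c : K),
        IntermediateField.adjoin K {w} = ⊤ ∧ w ^ 3 = algebraMap K L c)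
      ↔ ∃ r : K, r ^ 2 - r - 1 / a ^ 2 = 0 := by
  have : CharP L 2 := charP_of_injective_algebraMap (algebraMap K L).injective 2
  have h2K : (2 : K) = 0 := CharTwo.two_eq_zero
  have h2L : (2 : L) = 0 := CharTwo.two_eq_zero
  have hroot : y ^ 3 = y + algebraMap K L a := by
    have h := minpoly.aeval K y
    rw [hmin] at h
    simp only [map_sub, map_mul, map_pow, aeval_X, aeval_C, map_ofNat] at h
    linear_combination h + y * h2L
  have hy0 : y ≠ 0 := by
    rintro rfl
    have := (coeffs_eq_zero_of_quadratic_relation hdeg hy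
      (α := 0) (β := 1) (γ := 0) (by simp)).2.1
    exact one_ne_zero this
  have ha : a ≠ 0 := by
    rintro rfl
    have := (coeffs_eq_zero_of_quadratic_relation hdeg hy
      (α := 1) (β := 0) (γ := -1) (by
        apply mul_left_cancel₀ hy0
        simp only [map_zero, map_one, map_neg] at hroot ⊢
        linear_combination hroot)).1
    exact one_ne_zero this
  constructor
  · rintro ⟨w, c, hw, hc⟩
    obtain ⟨u, v, t, hwy⟩ := exists_eq_quadratic hdeg hy w
    have hcube := cube_eq_of_cube_eq_add hroot (algebraMap K L v) (algebraMap K L t)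
    have hz : algebraMap K L v * y + algebraMap K L t * y ^ 2 = w - algebraMap K L u := by
      rw [hwy]; ring
    rw [hz] at hcube
    obtain ⟨hu, hq, -⟩ := coeffs_eq_zero_of_quadratic_relation hdeg hw
      (α := -3 * u) (β := 3 * u ^ 2 - (v ^ 2 + a * v * t + t ^ 2))
      (γ := c - u ^ 3 + (v ^ 2 + a * v * t + t ^ 2) * u
        - a * (v ^ 3 + v * t ^ 2 + a * t ^ 3)) (by
        simp only [map_sub, map_add, map_mul, map_pow, map_neg, map_ofNat]
        linear_combination hcube - hc)
    have hu0 : u = 0 := by linear_combination hu + 2 * u * h2K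
    subst hu0
    have ht : t ≠ 0 := by
      rintro rfl
      have hv : v = 0 := by simpa using hq
      subst hv
      have := (coeffs_eq_zero_of_quadratic_relation hdeg hw
        (α := 0) (β := 1) (γ := 0) (by simp [hwy])).2.1
      exact one_ne_zero this
    refine ⟨v / (t * a), ?_⟩
    field_simp
    linear_combination -hq - (t * v * a + t ^ 2) * h2K
  · rintro ⟨r, hr⟩
    have hq : (a * r) ^ 2 + a * (a * r) * 1 + 1 ^ 2 = 0 := by
      field_simp at hr
      linear_combination hr + (a ^ 2 * r + 1) * h2K
    refine ⟨algebraMap K L (a * r) * y + algebraMap K L 1 * y ^ 2,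
      a * ((a * r) ^ 3 + a * r * 1 ^ 2 + a * 1 ^ 3), ?_, ?_⟩
    · refine adjoin_eq_top_of_notMem_range hdeg fun k hk => ?_
      have := (coeffs_eq_zero_of_quadratic_relation hdeg hy
        (α := 1) (β := a * r) (γ := -k) (by rw [map_neg, hk]; ring)).1
      exact one_ne_zero this
    · rw [cube_eq_of_cube_eq_add hroot]
      simp only [← map_pow, ← map_mul, ← map_add, hq]
      simp
end

section
/- Let K be a field of characteristic differentated from 3 and let L/K be a purely cubic field extension of degree 3 (so L = K(y) with y^3 = a ∈ K for some primitive element y). Then L/K is Galois if and only if K contains a primitive third root of unity, i.e., there exists ξ ∈ K with ξ^2 + ξ + 1 = 0. -/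
open Polynomial

theorem three_ne_zero_of_ringChar_ne_three {K : Type*} [Field K] (h : ringChar K ≠ 3) :
    (3 : K) ≠ 0 := by
  intro h0
  have hdvd : ringChar K ∣ 3 := ringChar.dvd (by exact_mod_cast h0)
  rcases (Nat.dvd_prime Nat.prime_three).1 hdvd with h1 | h1
  · exact CharP.ringChar_ne_one h1
  · exact h h1

theorem isPrimitiveRoot_three_of_sq_add_self_add_one_eq_zero {K : Type*} [Field K]
    (h3 : (3 : K) ≠ 0) {ξ : K} (hξ : ξ ^ 2 + ξ + 1 = 0) : IsPrimitiveRoot ξ 3 := by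
  have : NeZero ((3 : ℕ) : K) := ⟨by exact_mod_cast h3⟩
  rw [← isRoot_cyclotomic_iff, cyclotomic_three]
  simpa using hξ

theorem exists_algebraMap_eq_of_sq_add_self_add_one_eq_zero {K L : Type*} [Field K] [Field L]
    [Algebra K L] (hodd : Odd (Module.finrank K L)) {ζ : L} (hζ : ζ ^ 2 + ζ + 1 = 0) :
    ∃ ξ : K, algebraMap K L ξ = ζ := by
  have : FiniteDimensional K L := Module.finite_of_finrank_pos hodd.pos
  have hint : IsIntegral K ζ := Algebra.IsIntegral.isIntegral ζ
  have hdeg : (X ^ 2 + X + 1 : K[X]).natDegree = 2 := by compute_degree!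
  have hle : (minpoly K ζ).natDegree ≤ 2 := by
    rw [← hdeg]
    refine natDegree_le_of_dvd (minpoly.dvd K ζ (by simpa using hζ)) fun h => ?_
    simp [h] at hdeg
  have hoddmin := hodd.of_dvd_nat (minpoly.degree_dvd hint)
  have hone : (minpoly K ζ).natDegree = 1 := by
    obtain ⟨k, hk⟩ := hoddmin
    omega
  exact minpoly.natDegree_eq_one_iff.1 hone

/-- Let K be a field of characteristic different from 3 and let L/K be a purely cubic
field extension of degree 3. Then L/K is Galois if and only if K contains a primitive
third root of unity, i.e. there exists ξ ∈ K with ξ^2 + ξ + 1 = 0. -/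
theorem purely_cubic_galois_iff_third_root_of_unity
    (K L : Type*) [Field K] [Field L] [Algebra K L]
    (hchar : ringChar K ≠ 3)
    (hdeg : Module.finrank K L = 3)
    (hpc : ∃ (w : L) (c : K),
      IntermediateField.adjoin K {w} = ⊤ ∧ w ^ 3 = algebraMap K L c) :
    IsGalois K L ↔ ∃ ξ : K, ξ ^ 2 + ξ + 1 = 0 := by
  obtain ⟨w, c, hw, hc⟩ := hpc
  have : FiniteDimensional K L := Module.finite_of_finrank_pos (by omega)
  constructor
  · intro _
    have hcard : Nat.card Gal(L/K) = 3 := by rw [IsGalois.card_aut_eq_finrank, hdeg]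
    have : Nontrivial Gal(L/K) := Finite.one_lt_card_iff_nontrivial.1 (by omega)
    obtain ⟨σ, hσ⟩ := exists_ne (1 : Gal(L/K))
    have hσw : σ w ≠ w := fun h => hσ <| AlgEquiv.coe_toAlgHom_injective <|
      AlgHom.ext_of_adjoin_eq_top
        (Algebra.adjoin_eq_top_of_primitive_element (IsAlgebraic.of_finite K w) hw)
        (by simpa [Set.eqOn_singleton] using h)
    have hw0 : w ≠ 0 := by
      rintro rfl
      simp at hσw
    have hcube : σ w ^ 3 = w ^ 3 := by rw [← map_pow, hc, AlgEquiv.commutes]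
    have hζ : (σ w / w) ^ 2 + σ w / w + 1 = 0 := by
      field_simp
      apply mul_left_cancel₀ (sub_ne_zero.2 hσw)
      linear_combination hcube
    obtain ⟨ξ, hξ⟩ := exists_algebraMap_eq_of_sq_add_self_add_one_eq_zero (K := K)
      (by rw [hdeg]; decide) hζ
    refine ⟨ξ, (algebraMap K L).injective ?_⟩
    simpa [hξ] using hζ
  · rintro ⟨ξ, hξ⟩
    have hprim := isPrimitiveRoot_three_of_sq_add_self_add_one_eq_zero
      (three_ne_zero_of_ringChar_ne_three hchar) hξ
    have hK : (primitiveRoots (Module.finrank K L) K).Nonempty :=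
      ⟨ξ, (mem_primitiveRoots (by omega)).2 (hdeg ▸ hprim)⟩
    exact (((isCyclic_tfae K L hK).out 0 2 rfl rfl).2 ⟨w, ⟨c, by rw [hdeg, hc]⟩, hw⟩).1
end

section
/- Let F_q be a finite field with q elements, of odd characteristic, with q ≡ −1 (mod 3). A field extension L of the rational function field F_q(x) of degree 3 is Galois if and only if there exists a primitive element z of L/F_q(x) whose minimal polynomial is X^3 − 3X − b, where b = P/Q for some coprime polynomials P, Q ∈ F_q[x] of the form P = 2(A^2 − 3^{-1}B^2) and Q = A^2 + 3^{-1}B^2 for some coprime polynomials A, B ∈ F_q[x]. -/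
open Polynomial

theorem two_and_three_ne_zero_of_card_mod_three {F : Type*} [Field F] [Fintype F]
    (hchar : ringChar F ≠ 2) (hq : Fintype.card F % 3 = 2) : (2 : F) ≠ 0 ∧ (3 : F) ≠ 0 := by
  have h2 : (2 : F) ≠ 0 := Ring.two_ne_zero hchar
  refine ⟨h2, fun h3 => h2 ?_⟩
  have h : ((Fintype.card F : ℕ) : F) = 0 := Nat.cast_card_eq_zero F
  rw [← Nat.div_add_mod (Fintype.card F) 3, hq] at h
  push_cast at h
  simpa [h3] using h

/-- If `q ≡ 2 (mod 3)`, then `-3` is not a square in the field with `q` elements. -/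
theorem sq_ne_neg_three_of_card_mod_three {F : Type*} [Field F] [Fintype F]
    (hchar : ringChar F ≠ 2) (hq : Fintype.card F % 3 = 2) (r : F) : r ^ 2 ≠ -3 := by
  intro hr
  obtain ⟨h2, h3⟩ := two_and_three_ne_zero_of_card_mod_three hchar hq
  obtain ⟨ζ, rfl⟩ : ∃ ζ : F, r = 2 * ζ + 1 := ⟨(r - 1) / 2, by field_simp; ring⟩
  have hζ : ζ ^ 2 + ζ + 1 = 0 := by
    have : (2 * 2) * (ζ ^ 2 + ζ + 1) = 0 := by linear_combination hr
    exact (mul_eq_zero.mp this).resolve_left (mul_ne_zero h2 h2)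
  have hcube : ζ ^ 3 = 1 := by linear_combination (ζ - 1) * hζ
  have hpow : ζ ^ Fintype.card F = ζ := FiniteField.pow_card ζ
  rw [← Nat.div_add_mod (Fintype.card F) 3, hq, pow_add, pow_mul, hcube, one_pow, one_mul] at hpow
  exact h3 (by linear_combination 4 * hζ - (2 * ζ + 1) * (hζ - hpow))

/-- Over a field in which `-3` is not a square, `A ^ 2 + 3⁻¹ * B ^ 2` does not vanish for
coprime polynomials `A` and `B`. -/
theorem sq_add_sq_ne_zero_of_isCoprime {F : Type*} [Field F] (h3 : (3 : F) ≠ 0)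
    (hns : ∀ r : F, r ^ 2 ≠ -3) {A B : F[X]} (hAB : IsCoprime A B) :
    A ^ 2 + C (3 : F)⁻¹ * B ^ 2 ≠ 0 := by
  intro h
  have he := congrArg (eval 0) h
  simp only [eval_add, eval_mul, eval_pow, eval_C, eval_zero] at he
  field_simp at he
  have hA : eval 0 A = 0 := by
    by_contra hA
    refine hns (eval 0 B / eval 0 A) ?_
    field_simp
    linear_combination he
  have hB : eval 0 B = 0 := by simpa [hA] using he
  obtain ⟨u, v, huv⟩ := hAB
  simpa [hA, hB] using congrArg (eval 0) huv

theorem exists_isCoprime_mul_eq {F : Type*} [Field F] (a c : RatFunc F) (h : a ≠ 0 ∨ c ≠ 0) :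
    ∃ (A B : F[X]) (k : RatFunc F), IsCoprime A B ∧ k ≠ 0 ∧
      a = k * algebraMap F[X] (RatFunc F) A ∧ c = k * algebraMap F[X] (RatFunc F) B := by
  by_cases hc : c = 0
  · exact ⟨1, 0, a, isCoprime_one_left, h.resolve_right (not_not.mpr hc), by simp, by simp [hc]⟩
  · have hd : algebraMap F[X] (RatFunc F) (a / c).denom ≠ 0 :=
      RatFunc.algebraMap_ne_zero (RatFunc.denom_ne_zero _)
    refine ⟨(a / c).num, (a / c).denom, c / algebraMap F[X] (RatFunc F) (a / c).denom,
      RatFunc.isCoprime_num_denom _, div_ne_zero hc hd, ?_, by field_simp⟩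
    rw [div_mul_eq_mul_div, mul_div_assoc, RatFunc.num_div_denom]
    field_simp

theorem isCoprime_of_isCoprime_sq {F : Type*} [Field F] (h2 : (2 : F) ≠ 0) (h3 : (3 : F) ≠ 0)
    {A B : F[X]} (hAB : IsCoprime A B) :
    IsCoprime (2 * (A ^ 2 - C (3 : F)⁻¹ * B ^ 2)) (A ^ 2 + C (3 : F)⁻¹ * B ^ 2) := by
  obtain ⟨u, v, huv⟩ := hAB.pow (m := 2) (n := 2)
  have h22 : C (2 : F)⁻¹ * 2 = (1 : F[X]) := by
    rw [show (2 : F[X]) = C 2 from rfl, ← C_mul, inv_mul_cancel₀ h2, C_1]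
  have h33 : C (3 : F)⁻¹ * 3 = (1 : F[X]) := by
    rw [show (3 : F[X]) = C 3 from rfl, ← C_mul, inv_mul_cancel₀ h3, C_1]
  generalize C (2 : F)⁻¹ = i at *
  generalize C (3 : F)⁻¹ = j at *
  refine ⟨i ^ 2 * (u - 3 * v), i * (u + 3 * v), ?_⟩
  grind

theorem natDegree_and_monic_cubic {K : Type*} [Field K] (b : K) :
    (X ^ 3 - 3 * X - C b : K[X]).natDegree = 3 ∧ (X ^ 3 - 3 * X - C b : K[X]).Monic := by
  have h : (X ^ 3 - 3 * X - C b : K[X]) = X ^ 3 - (C 3 * X + C b) := by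
    rw [show (C 3 : K[X]) = 3 from rfl]; ring
  have hd : (C 3 * X + C b : K[X]).degree < 3 :=
    degree_linear_le.trans_lt (by norm_num)
  rw [h]
  constructor
  · compute_degree!
  · exact monic_X_pow_sub (n := 3) hd

theorem aeval_cubic {K L : Type*} [Field K] [Field L] [Algebra K L] (b : K) (z : L) :
    aeval z (X ^ 3 - 3 * X - C b : K[X]) = z ^ 3 - 3 * z - algebraMap K L b := by
  simp [map_ofNat]

/-- A cubic extension generated by a root of `X ^ 3 - 3 * X - b` is Galois if the discriminant
`27 * (4 - b ^ 2)` is a square. -/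
theorem isGalois_of_minpoly_cubic {K L : Type*} [Field K] [Field L] [Algebra K L]
    (h2 : (2 : K) ≠ 0) (h3 : (3 : K) ≠ 0) {z : L} {b d : K}
    (hz : IntermediateField.adjoin K {z} = ⊤) (hmin : minpoly K z = X ^ 3 - 3 * X - C b)
    (hd : d ^ 2 = 27 * (4 - b ^ 2)) : IsGalois K L := by
  have h2L : (2 : L) ≠ 0 := by
    rw [← map_ofNat (algebraMap K L) 2]
    exact (_root_.map_ne_zero _).mpr h2
  obtain ⟨hdeg, hmonic⟩ := natDegree_and_monic_cubic b
  have hint : IsIntegral K z := by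
    by_contra hn
    rw [minpoly.eq_zero hn] at hmin
    exact hmonic.ne_zero hmin.symm
  have hirr : Irreducible (X ^ 3 - 3 * X - C b : K[X]) := hmin ▸ minpoly.irreducible hint
  have hder : derivative (X ^ 3 - 3 * X - C b : K[X]) = C 3 * X ^ 2 - C 3 := by
    have h : (C 2 + 1 : K[X]) = C 3 := by rw [← C_1, ← C_add]; norm_num
    rw [show (3 : K[X]) = C 3 from rfl]
    simp [h]
  have hder0 : derivative (X ^ 3 - 3 * X - C b : K[X]) ≠ 0 := by
    rw [hder]
    intro h
    have := congrArg (fun p => coeff p 2) h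
    simp [h3] at this
  have hsep : (X ^ 3 - 3 * X - C b : K[X]).Separable :=
    (separable_iff_derivative_ne_zero hirr).mpr hder0
  have hroot : z ^ 3 - 3 * z - algebraMap K L b = 0 := by
    rw [← aeval_cubic, ← hmin, minpoly.aeval]
  have hder_z : 3 * z ^ 2 - 3 ≠ 0 := by
    have := hsep.aeval_derivative_ne_zero (x := z) (by rw [aeval_cubic, hroot])
    simpa [hder, map_ofNat] using this
  have hdL : algebraMap K L d ^ 2 = 27 * (4 - algebraMap K L b ^ 2) := by
    simpa [map_ofNat] using congrArg (algebraMap K L) hd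
  set e : L := algebraMap K L d / (3 * z ^ 2 - 3) with he
  have he2 : e ^ 2 = 12 - 3 * z ^ 2 := by
    rw [he, div_pow, div_eq_iff (pow_ne_zero 2 hder_z), hdL]
    linear_combination (27 * (z ^ 3 - 3 * z + algebraMap K L b)) * hroot
  have hsplit : ((X ^ 3 - 3 * X - C b : K[X]).map (algebraMap K L)).Splits := by
    have hfac : (X ^ 3 - 3 * X - C b : K[X]).map (algebraMap K L) =
        (X - C z) * (X - C ((-z + e) / 2)) * (X - C ((-z - e) / 2)) := by
      have hs : (-z + e) / 2 + (-z - e) / 2 = -z := by field_simp; ring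
      have hp : (-z + e) / 2 * ((-z - e) / 2) = z ^ 2 - 3 := by
        field_simp
        linear_combination -he2
      have hs' := congrArg (C : L → L[X]) hs
      have hp' := congrArg (C : L → L[X]) hp
      have hr' := congrArg (C : L → L[X]) hroot
      simp only [C_add, C_mul, C_sub, C_pow, C_neg, C_0, show (C 3 : L[X]) = 3 from rfl]
        at hs' hp' hr'
      simp only [Polynomial.map_sub, Polynomial.map_mul, Polynomial.map_pow, map_X, map_C,
        Polynomial.map_ofNat]
      generalize (C ((-z + e) / 2) : L[X]) = p at *
      generalize (C ((-z - e) / 2) : L[X]) = q at *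
      linear_combination hr' + (X - C z) * X * hs' - (X - C z) * hp'
    rw [hfac]
    exact ((Splits.X_sub_C _).mul (Splits.X_sub_C _)).mul (Splits.X_sub_C _)
  have hsf : IsSplittingField K L (X ^ 3 - 3 * X - C b) := by
    refine ⟨hsplit, ?_⟩
    have hmem : z ∈ (X ^ 3 - 3 * X - C b : K[X]).rootSet L :=
      mem_rootSet.mpr ⟨hmonic.ne_zero, by rw [aeval_cubic, hroot]⟩
    have hz' : Algebra.adjoin K {z} = ⊤ := by
      rw [← IntermediateField.adjoin_simple_toSubalgebra_of_isAlgebraic hint.isAlgebraic, hz,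
        IntermediateField.top_toSubalgebra]
    exact top_le_iff.mp (hz' ▸ Algebra.adjoin_mono (Set.singleton_subset_iff.mpr hmem))
  exact IsGalois.of_separable_splitting_field hsep

/-- A Galois cubic extension has a nonzero pair `(s, t)` on which a generator `σ` of the Galois
group acts as multiplication of `s + t * √-3` by a primitive cube root of unity. -/
theorem exists_cubic_lagrange_resolvent {K L : Type*} [Field K] [Field L] [Algebra K L]
    (h2 : (2 : L) ≠ 0) (hdeg : Module.finrank K L = 3) [IsGalois K L] :
    ∃ (σ : L ≃ₐ[K] L) (s t : L), t ≠ 0 ∧ σ s = -(s + 3 * t) / 2 ∧ σ t = (s - t) / 2 ∧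
      ∀ x, σ x = x → x ∈ (algebraMap K L).range := by
  have : FiniteDimensional K L := Module.finite_of_finrank_pos (by omega)
  have hcard : Nat.card (L ≃ₐ[K] L) = 3 := by rw [IsGalois.card_aut_eq_finrank, hdeg]
  have : Nontrivial (L ≃ₐ[K] L) := Finite.one_lt_card_iff_nontrivial.mp (by omega)
  obtain ⟨σ, hσ⟩ := exists_ne (1 : L ≃ₐ[K] L)
  obtain ⟨y, hy⟩ : ∃ y, σ y ≠ y := by
    by_contra! h
    exact hσ (AlgEquiv.ext h)
  have hσ3 : ∀ x, σ (σ (σ x)) = x := by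
    intro x
    have h : σ ^ 3 = 1 := hcard ▸ pow_card_eq_one'
    simpa [pow_succ] using congrArg (fun f : L ≃ₐ[K] L => f x) h
  have hgen : Subgroup.zpowers σ = ⊤ :=
    have : Fact (Nat.Prime 3) := ⟨Nat.prime_three⟩
    zpowers_eq_top_of_prime_card hcard hσ
  refine ⟨σ, y - (σ y + σ (σ y)) / 2, (σ (σ y) - σ y) / 2, ?_, ?_, ?_, ?_⟩
  · refine div_ne_zero (sub_ne_zero.mpr fun h => hy ?_) h2
    exact σ.injective h
  · simp only [map_sub, map_add, map_div₀, map_ofNat, hσ3]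
    field_simp
    ring
  · simp only [map_sub, map_div₀, map_ofNat, hσ3]
    field_simp
    ring
  · intro x hx
    refine (IsGalois.mem_range_algebraMap_iff_fixed x).mpr fun f => ?_
    have hf : f ∈ Subgroup.zpowers σ := hgen ▸ Subgroup.mem_top f
    have hle : Subgroup.zpowers σ ≤ MulAction.stabilizer (L ≃ₐ[K] L) x :=
      Subgroup.zpowers_le.mpr hx
    exact hle hf

/-- In a Galois cubic extension of a field in which `a ^ 2 + 3 * c ^ 2` is anisotropic, there is
a primitive element with minimal polynomial
`X ^ 3 - 3 * X - 2 * (a ^ 2 - 3 * c ^ 2) / (a ^ 2 + 3 * c ^ 2)`. -/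
theorem exists_minpoly_cubic_of_isGalois {K L : Type*} [Field K] [Field L] [Algebra K L]
    (h2 : (2 : K) ≠ 0) (h3 : (3 : K) ≠ 0)
    (hns : ∀ a c : K, a ≠ 0 ∨ c ≠ 0 → a ^ 2 + 3 * c ^ 2 ≠ 0)
    (hdeg : Module.finrank K L = 3) [IsGalois K L] :
    ∃ (z : L) (a c : K), (a ≠ 0 ∨ c ≠ 0) ∧ IntermediateField.adjoin K {z} = ⊤ ∧
      minpoly K z = X ^ 3 - 3 * X - C (2 * (a ^ 2 - 3 * c ^ 2) / (a ^ 2 + 3 * c ^ 2)) := by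
  have h2L : (2 : L) ≠ 0 := by
    rw [← map_ofNat (algebraMap K L) 2]
    exact (_root_.map_ne_zero _).mpr h2
  have h3L : (3 : L) ≠ 0 := by
    rw [← map_ofNat (algebraMap K L) 3]
    exact (_root_.map_ne_zero _).mpr h3
  have : FiniteDimensional K L := Module.finite_of_finrank_pos (by omega)
  obtain ⟨σ, s, t, ht, hs_map, ht_map, hfix⟩ := exists_cubic_lagrange_resolvent (K := K) h2L hdeg
  obtain ⟨a, ha⟩ := hfix (s ^ 3 - 9 * s * t ^ 2) (by
    simp only [map_sub, map_mul, map_pow, map_ofNat, hs_map, ht_map]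
    field_simp
    ring)
  obtain ⟨c, hc⟩ := hfix (3 * s ^ 2 * t - 3 * t ^ 3) (by
    simp only [map_sub, map_mul, map_pow, map_ofNat, hs_map, ht_map]
    field_simp
    ring)
  have hac : a ≠ 0 ∨ c ≠ 0 := by
    by_contra! h
    rw [h.1, map_zero] at ha
    rw [h.2, map_zero] at hc
    have hst : s ^ 2 = t ^ 2 :=
      mul_left_cancel₀ (mul_ne_zero h3L ht) (by linear_combination -hc)
    have h8 : (2 * 2 * 2) * (s * t ^ 2) = 0 := by linear_combination ha + s * hst
    have hs0 : s = 0 := by simpa [h2L, ht] using h8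
    exact ht (by simpa [hs0] using hst.symm)
  have hn := hns a c hac
  have hnL : algebraMap K L a ^ 2 + 3 * algebraMap K L c ^ 2 ≠ 0 := by
    simpa [map_ofNat] using (_root_.map_ne_zero (algebraMap K L)).mpr hn
  have hnorm : algebraMap K L a ^ 2 + 3 * algebraMap K L c ^ 2 = (s ^ 2 + 3 * t ^ 2) ^ 3 := by
    rw [ha, hc]; ring
  have hst0 : s ^ 2 + 3 * t ^ 2 ≠ 0 := fun h => hnL (by rw [hnorm, h]; ring)
  set z : L := 2 * (s ^ 2 - 3 * t ^ 2) / (s ^ 2 + 3 * t ^ 2) with hz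
  set b : K := 2 * (a ^ 2 - 3 * c ^ 2) / (a ^ 2 + 3 * c ^ 2) with hb
  have hroot : z ^ 3 - 3 * z - algebraMap K L b = 0 := by
    have : algebraMap K L b =
        2 * (algebraMap K L a ^ 2 - 3 * algebraMap K L c ^ 2) / (s ^ 2 + 3 * t ^ 2) ^ 3 := by
      rw [← hnorm, hb]; simp [map_ofNat]
    rw [this, ha, hc, hz]
    field_simp
    ring
  have hz_not : z ∉ (algebraMap K L).range := by
    rintro ⟨w, hw⟩
    have hσz : σ z = z := by rw [← hw]; exact σ.commutes w
    have hσn : σ (s ^ 2 + 3 * t ^ 2) = s ^ 2 + 3 * t ^ 2 := by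
      simp only [map_add, map_mul, map_pow, map_ofNat, hs_map, ht_map]
      field_simp
      ring
    have hnum : σ (s ^ 2 - 3 * t ^ 2) = s ^ 2 - 3 * t ^ 2 := by
      rw [hz, map_div₀, hσn, div_left_inj' hst0, map_mul, map_ofNat] at hσz
      exact mul_left_cancel₀ h2L hσz
    simp only [map_sub, map_mul, map_pow, map_ofNat, hs_map, ht_map] at hnum
    field_simp at hnum
    have hprod : (2 * 3) * ((s - 3 * t) * (s + t)) = 0 := by linear_combination -hnum
    have hprod' := (mul_eq_zero.mp hprod).resolve_left (mul_ne_zero h2L h3L)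
    rcases mul_eq_zero.mp hprod' with h | h
    · have h' := congrArg σ h
      simp only [map_sub, map_mul, map_ofNat, map_zero, hs_map, ht_map] at h'
      field_simp at h'
      have : (2 * 2 * 3) * t = 0 := by linear_combination -h' - 4 * h
      simp [h2L, h3L, ht] at this
    · have h' := congrArg σ h
      simp only [map_add, map_zero, hs_map, ht_map] at h'
      field_simp at h'
      have : (2 * 2) * t = 0 := by linear_combination -h'
      simp [h2L, ht] at this
  have htop : IntermediateField.adjoin K {z} = ⊤ := by
    have := IntermediateField.isSimpleOrder_of_finrank_prime K L (hdeg ▸ Nat.prime_three)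
    refine (eq_bot_or_eq_top _).resolve_left fun h => hz_not ?_
    exact IntermediateField.mem_bot.mp (IntermediateField.adjoin_simple_eq_bot_iff.mp h)
  obtain ⟨hnat, hmonic⟩ := natDegree_and_monic_cubic b
  have hint : IsIntegral K z := .of_finite K z
  refine ⟨z, a, c, hac, htop, ?_⟩
  refine (eq_of_monic_of_dvd_of_natDegree_le (minpoly.monic hint) hmonic
    (minpoly.dvd K z (by rw [aeval_cubic, hroot])) ?_).symm
  rw [hnat, ← IntermediateField.adjoin.finrank hint, htop, IntermediateField.finrank_top', hdeg]

/-- Let F_q be a finite field with q elements, of odd characteristic, with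
q ≡ −1 (mod 3). A field extension L of F_q(x) of degree 3 is Galois if and only if there
exists a primitive element z of L/F_q(x) whose minimal polynomial is X^3 − 3X − b, where
b = P/Q for coprime P, Q ∈ F_q[x] of the form P = 2(A^2 − 3⁻¹B^2), Q = A^2 + 3⁻¹B^2 with
A, B ∈ F_q[x] coprime. -/
theorem galois_criterion_odd_char
    (F : Type*) [Field F] [Fintype F]
    (hchar : ringChar F ≠ 2)
    (hq : Fintype.card F % 3 = 2)
    (L : Type*) [Field L] [Algebra (RatFunc F) L]
    (hdeg : Module.finrank (RatFunc F) L = 3) :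
    IsGalois (RatFunc F) L ↔
      ∃ (z : L) (P Q A B : Polynomial F),
        IntermediateField.adjoin (RatFunc F) {z} = ⊤ ∧
        IsCoprime P Q ∧ IsCoprime A B ∧
        P = 2 * (A ^ 2 - Polynomial.C (3 : F)⁻¹ * B ^ 2) ∧
        Q = A ^ 2 + Polynomial.C (3 : F)⁻¹ * B ^ 2 ∧
        minpoly (RatFunc F) z =
          X ^ 3 - 3 * X -
            C (algebraMap (Polynomial F) (RatFunc F) P /
               algebraMap (Polynomial F) (RatFunc F) Q) := by
  obtain ⟨h2, h3⟩ := two_and_three_ne_zero_of_card_mod_three hchar hq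
  have h2K : (2 : RatFunc F) ≠ 0 := by
    rw [← map_ofNat (algebraMap F (RatFunc F)) 2]
    exact (_root_.map_ne_zero _).mpr h2
  have h3K : (3 : RatFunc F) ≠ 0 := by
    rw [← map_ofNat (algebraMap F (RatFunc F)) 3]
    exact (_root_.map_ne_zero _).mpr h3
  have hns := sq_ne_neg_three_of_card_mod_three hchar hq
  have hC : algebraMap F[X] (RatFunc F) (C (3 : F)⁻¹) = 3⁻¹ := by
    rw [RatFunc.algebraMap_C, map_inv₀, map_ofNat]
  have hQ : ∀ {A B : F[X]}, IsCoprime A B → algebraMap F[X] (RatFunc F) A ^ 2 +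
      3⁻¹ * algebraMap F[X] (RatFunc F) B ^ 2 ≠ 0 := fun hAB => by
    simpa [hC] using RatFunc.algebraMap_ne_zero (sq_add_sq_ne_zero_of_isCoprime h3 hns hAB)
  constructor
  · intro hgal
    obtain ⟨z, a, c, hac, htop, hmin⟩ := exists_minpoly_cubic_of_isGalois (L := L) h2K h3K
      (fun a c hac h => by
        obtain ⟨A, B, k, hAB, hk, rfl, hc⟩ := exists_isCoprime_mul_eq a (3 * c)
          (hac.imp_right (mul_ne_zero h3K))
        refine hQ hAB (mul_left_cancel₀ (pow_ne_zero 2 hk) ?_)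
        have hi : (3 : RatFunc F) * 3⁻¹ = 1 := mul_inv_cancel₀ h3K
        linear_combination h - 3⁻¹ * (3 * c + k * algebraMap F[X] (RatFunc F) B) * hc +
          3 * c ^ 2 * hi) hdeg
    obtain ⟨A, B, k, hAB, hk, hA, hB⟩ := exists_isCoprime_mul_eq a (3 * c)
      (hac.imp_right (mul_ne_zero h3K))
    refine ⟨z, _, _, A, B, htop, isCoprime_of_isCoprime_sq h2 h3 hAB, hAB, rfl, rfl, ?_⟩
    have hc : c = k * algebraMap F[X] (RatFunc F) B / 3 := by rw [← hB]; field_simp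
    rw [hmin, hA, hc]
    congr 2
    simp only [map_mul, map_add, map_sub, map_pow, hC, map_ofNat]
    rw [show (k * algebraMap F[X] (RatFunc F) A) ^ 2 +
        3 * (k * algebraMap F[X] (RatFunc F) B / 3) ^ 2 =
        k ^ 2 * (algebraMap F[X] (RatFunc F) A ^ 2 +
          3⁻¹ * algebraMap F[X] (RatFunc F) B ^ 2) by field_simp,
      div_eq_div_iff (mul_ne_zero (pow_ne_zero 2 hk) (hQ hAB)) (hQ hAB)]
    field_simp
  · rintro ⟨z, P, Q, A, B, htop, -, hAB, rfl, rfl, hmin⟩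
    have hne := hQ hAB
    refine isGalois_of_minpoly_cubic h2K h3K (d := 12 * algebraMap F[X] (RatFunc F) A *
      algebraMap F[X] (RatFunc F) B / (algebraMap F[X] (RatFunc F) A ^ 2 +
      3⁻¹ * algebraMap F[X] (RatFunc F) B ^ 2)) htop hmin ?_
    simp only [map_mul, map_add, map_sub, map_pow, hC, map_ofNat]
    rw [div_pow, div_pow, eq_comm, ← sub_eq_zero]
    generalize hn : algebraMap F[X] (RatFunc F) A ^ 2 +
      3⁻¹ * algebraMap F[X] (RatFunc F) B ^ 2 = n at *
    field_simp
    rw [← hn]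
    field_simp
    ring
end

section
/- Let F_q be a finite field with q elements of characteristic 2 with q ≡ −1 (mod 3). A field extension L of the rational function field F_q(x) of degree 3 is Galois if and only if there exists a primitive element z of L/F_q(x) whose minimal polynomial is X^3 − 3X − b, where b = P/Q for some coprime polynomials P, Q ∈ F_q[x] of the form P = A^2 and Q = A^2 + AB + B^2 for some coprime polynomials A, B ∈ F_q[x]. -/
open Polynomial

/-- Over a finite field with `q ≡ 2 (mod 3)` elements, the norm form `a² + ab + b²` of the cube
roots of unity is anisotropic. -/
lemma eq_zero_of_sq_add_mul_add_sq_eq_zero {F : Type*} [Field F] [Fintype F] [CharP F 2]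
    (hq : Fintype.card F % 3 = 2) {a b : F} (h : a ^ 2 + a * b + b ^ 2 = 0) :
    a = 0 ∧ b = 0 := by
  have h2 : (2 : F) = 0 := CharTwo.two_eq_zero
  have hcube : a ^ 3 = b ^ 3 := by linear_combination (a - b) * h
  have hcard : Fintype.card F = 3 * (Fintype.card F / 3) + 2 := by omega
  have hpow : ∀ c : F, c = (c ^ 3) ^ (Fintype.card F / 3) * c ^ 2 := fun c => by
    conv_lhs => rw [← FiniteField.pow_card c, hcard]
    rw [pow_add, pow_mul]
  generalize Fintype.card F / 3 = m at hpow
  have ha := hpow a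
  have hb := hpow b
  rw [← hcube] at hb
  by_cases h0 : a = 0
  · subst h0
    simpa using h
  · set t := (a ^ 3) ^ m
    have hta : t * a = 1 := by
      apply mul_right_cancel₀ h0
      linear_combination -ha
    have hab : a = b := by
      have hb0 : b ≠ 0 := by
        rintro rfl
        exact h0 (by simpa using h)
      have htb : t * b = 1 := by
        apply mul_right_cancel₀ hb0
        linear_combination -hb
      exact mul_left_cancel₀ (left_ne_zero_of_mul_eq_one hta) (hta.trans htb.symm)
    subst hab
    have : a ^ 2 = 0 := by linear_combination h - a ^ 2 * h2
    exact absurd (pow_eq_zero_iff two_ne_zero |>.mp this) h0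

lemma RatFunc.sq_add_self_add_one_ne_zero {F : Type*} [Field F] [Fintype F] [CharP F 2]
    (hq : Fintype.card F % 3 = 2) (u : RatFunc F) : u ^ 2 + u + 1 ≠ 0 := by
  intro h
  have hd : algebraMap F[X] (RatFunc F) u.denom ≠ 0 := by simpa using u.denom_ne_zero
  have hpoly : u.num ^ 2 + u.num * u.denom + u.denom ^ 2 = 0 := by
    apply RatFunc.algebraMap_injective F
    rw [← u.num_div_denom] at h
    field_simp at h
    simp only [map_add, map_mul, map_pow, map_zero]
    linear_combination h
  have heval := congrArg (Polynomial.eval 0) hpoly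
  simp only [Polynomial.eval_add, Polynomial.eval_mul, Polynomial.eval_pow,
    Polynomial.eval_zero] at heval
  obtain ⟨ha, hb⟩ := eq_zero_of_sq_add_mul_add_sq_eq_zero hq heval
  obtain ⟨s, t, hst⟩ := u.isCoprime_num_denom
  simpa [ha, hb] using congrArg (Polynomial.eval 0) hst

lemma RatFunc.exists_isCoprime_inv_sq_add_self_add_one {F : Type*} [Field F] (u : RatFunc F) :
    ∃ A B : F[X], IsCoprime A B ∧ (u ^ 2 + u + 1)⁻¹ =
      algebraMap F[X] (RatFunc F) (A ^ 2) /
        algebraMap F[X] (RatFunc F) (A ^ 2 + A * B + B ^ 2) := by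
  refine ⟨u.denom, u.num, u.isCoprime_num_denom.symm, ?_⟩
  have hd : algebraMap F[X] (RatFunc F) u.denom ≠ 0 := by simpa using u.denom_ne_zero
  have hu : u * algebraMap F[X] (RatFunc F) u.denom = algebraMap F[X] (RatFunc F) u.num :=
    (eq_div_iff hd).mp u.num_div_denom.symm
  simp only [map_add, map_mul, map_pow, ← hu]
  rw [show algebraMap F[X] (RatFunc F) u.denom ^ 2 + algebraMap F[X] (RatFunc F) u.denom *
      (u * algebraMap F[X] (RatFunc F) u.denom) + (u * algebraMap F[X] (RatFunc F) u.denom) ^ 2 =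
      algebraMap F[X] (RatFunc F) u.denom ^ 2 * (u ^ 2 + u + 1) by ring,
    div_mul_eq_div_div, div_self (pow_ne_zero 2 hd), one_div]

lemma IsCoprime.sq_sq_add_mul_add_sq {R : Type*} [CommRing R] {a b : R} (h : IsCoprime a b) :
    IsCoprime (a ^ 2) (a ^ 2 + a * b + b ^ 2) := by
  refine IsCoprime.pow_left ?_
  rw [show a ^ 2 + a * b + b ^ 2 = b ^ 2 + a * (a + b) by ring]
  exact h.pow_right.add_mul_left_right _

section Galois

variable {K L : Type*} [Field K] [Field L] [Algebra K L]

/-- The Galois group of a Galois cubic extension is generated by an element of order three. -/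
lemma exists_algEquiv_generator_of_finrank_eq_three [IsGalois K L]
    (hdeg : Module.finrank K L = 3) :
    ∃ σ : L ≃ₐ[K] L, (∀ x, σ (σ (σ x)) = x) ∧ (∃ x, σ x ≠ x) ∧
      ∀ x, σ x = x → ∃ k, algebraMap K L k = x := by
  have : FiniteDimensional K L := Module.finite_of_finrank_pos (by omega)
  have hcard : Nat.card (L ≃ₐ[K] L) = 3 := by rw [IsGalois.card_aut_eq_finrank, hdeg]
  have : Fact (Nat.Prime 3) := ⟨Nat.prime_three⟩
  have : Nontrivial (L ≃ₐ[K] L) := Finite.one_lt_card_iff_nontrivial.mp (by omega)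
  obtain ⟨σ, hσ⟩ := exists_ne (1 : L ≃ₐ[K] L)
  refine ⟨σ, fun x => ?_, ?_, fun x hx => ?_⟩
  · have h : σ ^ 3 = 1 := by rw [← hcard, pow_card_eq_one']
    simpa [pow_succ] using DFunLike.congr_fun h x
  · by_contra! h
    exact hσ (AlgEquiv.ext h)
  · rw [← Set.mem_range, ← IntermediateField.mem_bot, IsGalois.mem_bot_iff_fixed]
    intro τ
    have hτ : τ ∈ Subgroup.zpowers σ := mem_zpowers_of_prime_card hcard hσ
    have hle : Subgroup.zpowers σ ≤ MulAction.stabilizer (L ≃ₐ[K] L) x :=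
      Subgroup.zpowers_le.mpr hx
    exact hle hτ

lemma minpoly_eq_of_natDegree_eq_three (hdeg : Module.finrank K L = 3) {z : L}
    (hz : z ∉ (algebraMap K L).range) {f : K[X]} (hf : f.Monic) (hf3 : f.natDegree = 3)
    (hroot : aeval z f = 0) : minpoly K z = f := by
  have : FiniteDimensional K L := Module.finite_of_finrank_pos (by omega)
  have hint : IsIntegral K z := .of_finite K z
  have hdvd : (minpoly K z).natDegree ∣ 3 := hdeg ▸ minpoly.degree_dvd hint
  have h3 : (minpoly K z).natDegree = 3 :=
    ((Nat.dvd_prime Nat.prime_three).mp hdvd).resolve_left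
      fun h => hz (minpoly.natDegree_eq_one_iff.mp h)
  exact (eq_of_monic_of_dvd_of_natDegree_le (minpoly.monic hint) hf (minpoly.dvd K z hroot)
    (by omega)).symm

variable [CharP K 2]

/-- If `σ` has order three and the base field of characteristic two has no primitive cube roots of
unity, some element has trace zero and second symmetric function of its conjugates equal to one. -/
lemma exists_conjugates_sq_add_mul_add_sq_eq_one
    (hK : ∀ u : K, u ^ 2 + u + 1 ≠ 0) {σ : L ≃ₐ[K] L} (hσ3 : ∀ x, σ (σ (σ x)) = x)
    (hσ : ∃ x, σ x ≠ x) (hfix : ∀ x, σ x = x → ∃ k, algebraMap K L k = x) :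
    ∃ z : L, σ (σ z) = z + σ z ∧ z ^ 2 + z * σ z + σ z ^ 2 = 1 := by
  have : CharP L 2 := charP_of_injective_algebraMap (algebraMap K L).injective 2
  have h2 : (2 : L) = 0 := CharTwo.two_eq_zero
  obtain ⟨x, hx⟩ := hσ
  obtain ⟨y, hy0, hy⟩ : ∃ y : L, y ≠ 0 ∧ σ (σ y) = y + σ y := by
    refine ⟨x + σ x, fun h => hx ?_, ?_⟩
    · linear_combination h - x * h2
    · simp only [map_add, hσ3]
      linear_combination (-σ x) * h2
  have hn : y ^ 2 + y * σ y + σ y ^ 2 ≠ 0 := by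
    intro h
    set w := σ y / y with hw
    have hw1 : w ^ 2 + w + 1 = 0 := by
      rw [hw]
      field_simp
      linear_combination h
    have hσw : σ w = w := by
      have hσy : σ y = w * y := by rw [hw]; field_simp
      have := congrArg σ hσy
      rw [hy, map_mul, hσy] at this
      have hw0 : w ≠ 0 := by
        intro h0
        simp [h0] at hw1
      apply mul_right_cancel₀ (mul_ne_zero hw0 hy0)
      linear_combination -this + hw1 * y - y * w ^ 2 * h2
    obtain ⟨k, hk⟩ := hfix w hσw
    apply hK k
    apply (algebraMap K L).injective
    simpa [hk] using hw1
  set n := y ^ 2 + y * σ y + σ y ^ 2 with hndef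
  have hσn : σ n = n := by
    simp only [hndef, map_add, map_mul, map_pow, hy]
    linear_combination (σ y ^ 2 + y * σ y) * h2
  set a := y ^ 3 + σ y ^ 3 + y * σ y ^ 2 with ha
  set b := y ^ 2 * σ y + y * σ y ^ 2 with hb
  have hσa : σ a = a := by
    simp only [ha, map_add, map_mul, map_pow, hy]
    grind
  have hσb : σ b = b := by
    simp only [hb, map_add, map_mul, map_pow, hy]
    grind
  have hnorm : a ^ 2 + a * b + b ^ 2 = n ^ 3 := by grind
  refine ⟨a / n ^ 2 * y + b / n ^ 2 * σ y, ?_, ?_⟩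
  · simp only [map_add, map_mul, map_div₀, map_pow, hσa, hσb, hσn, hy]
    ring
  · simp only [map_add, map_mul, map_div₀, map_pow, hσa, hσb, hσn, hy]
    have : (a / n ^ 2) ^ 2 + a / n ^ 2 * (b / n ^ 2) + (b / n ^ 2) ^ 2 = 1 / n := by
      field_simp
      linear_combination hnorm
    have h1 : ((a / n ^ 2) ^ 2 + a / n ^ 2 * (b / n ^ 2) + (b / n ^ 2) ^ 2) * n = 1 := by
      rw [this]; field_simp
    generalize a / n ^ 2 = a' at *
    generalize b / n ^ 2 = b' at *
    rw [hndef] at h1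
    grind

/-- A Galois cubic extension in characteristic two, over a field without primitive cube roots of
unity, is generated by a root of `X³ - 3X - (u² + u + 1)⁻¹` for some `u` in the base field. -/
lemma exists_minpoly_eq_of_isGalois_of_finrank_eq_three [IsGalois K L]
    (hdeg : Module.finrank K L = 3) (hK : ∀ u : K, u ^ 2 + u + 1 ≠ 0) :
    ∃ (z : L) (u : K), IntermediateField.adjoin K {z} = ⊤ ∧
      minpoly K z = X ^ 3 - 3 * X - C (u ^ 2 + u + 1)⁻¹ := by
  have : CharP L 2 := charP_of_injective_algebraMap (algebraMap K L).injective 2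
  have h2 : (2 : L) = 0 := CharTwo.two_eq_zero
  have : FiniteDimensional K L := Module.finite_of_finrank_pos (by omega)
  obtain ⟨σ, hσ3, hσ, hfix⟩ := exists_algEquiv_generator_of_finrank_eq_three hdeg
  obtain ⟨z, hz, hz1⟩ := exists_conjugates_sq_add_mul_add_sq_eq_one hK hσ3 hσ hfix
  have hz0 : z ≠ 0 := by
    rintro rfl
    simp at hz1
  have hσz0 : σ z ≠ 0 := by simpa using hz0
  have hzσ : z + σ z ≠ 0 := by simpa [← hz] using hz0
  set b := z * σ z * (z + σ z) with hb
  have hb0 : b ≠ 0 := mul_ne_zero (mul_ne_zero hz0 hσz0) hzσ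
  have hσb : σ b = b := by
    simp only [hb, map_add, map_mul, hz]
    linear_combination σ z ^ 2 * (z + σ z) * h2
  set w := z ^ 2 * σ z + σ z ^ 3 + z ^ 3 with hw
  have hσw : σ w = w := by
    simp only [hw, map_add, map_mul, map_pow, hz]
    grind
  obtain ⟨u, hu⟩ := hfix ((w + 1) / b) (by simp [hσw, hσb])
  have hub : algebraMap K L (u ^ 2 + u + 1)⁻¹ = b := by
    have hwb : w ^ 2 + w * b + b ^ 2 = 1 := by grind
    rw [map_inv₀, inv_eq_iff_eq_inv]
    apply eq_inv_of_mul_eq_one_left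
    simp only [map_add, map_pow, map_one, hu]
    field_simp
    linear_combination hwb + (w + 1) * h2
  have hzK : z ∉ (algebraMap K L).range := by
    rintro ⟨k, rfl⟩
    apply hzσ
    rw [σ.commutes]
    linear_combination algebraMap K L k * h2
  have hmin : minpoly K z = X ^ 3 - 3 * X - C (u ^ 2 + u + 1)⁻¹ := by
    have h3 : (3 : K[X]) = C 3 := rfl
    refine minpoly_eq_of_natDegree_eq_three hdeg hzK ?_ ?_ ?_
    · rw [h3]; monicity!
    · rw [h3]; compute_degree!
    · simp only [map_sub, map_pow, map_mul, aeval_X, aeval_C, hub, map_ofNat]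
      grind
  refine ⟨z, u, ?_, hmin⟩
  rw [Field.primitive_element_iff_minpoly_natDegree_eq, hmin, hdeg,
    show (3 : K[X]) = C 3 from rfl]
  compute_degree!

/-- Roots of `X³ - 3X - (u² + u + 1)⁻¹` generate Galois cubic extensions in characteristic two. -/
lemma isGalois_of_minpoly_eq (hdeg : Module.finrank K L = 3) {z : L}
    (htop : IntermediateField.adjoin K {z} = ⊤) {u : K} (hu : u ^ 2 + u + 1 ≠ 0)
    (hmin : minpoly K z = X ^ 3 - 3 * X - C (u ^ 2 + u + 1)⁻¹) : IsGalois K L := by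
  have : CharP L 2 := charP_of_injective_algebraMap (algebraMap K L).injective 2
  have h2 : (2 : L) = 0 := CharTwo.two_eq_zero
  have : FiniteDimensional K L := Module.finite_of_finrank_pos (by omega)
  set b := (u ^ 2 + u + 1)⁻¹ with hb
  have hb0 : b ≠ 0 := inv_ne_zero hu
  have hbu : b * (u ^ 2 + u + 1) = 1 := inv_mul_cancel₀ hu
  have hbL : algebraMap K L b * (algebraMap K L u ^ 2 + algebraMap K L u + 1) = 1 := by
    simpa using congrArg (algebraMap K L) hbu
  have hroot : z ^ 3 - 3 * z - algebraMap K L b = 0 := by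
    simpa [hmin, map_ofNat (aeval z : K[X] →ₐ[K] L) 3] using minpoly.aeval K z
  have hz1 : z + 1 ≠ 0 := by
    intro h
    have hzm : z = algebraMap K L 1 := by
      rw [map_one]
      linear_combination h - h2
    have hnat := (Field.primitive_element_iff_minpoly_natDegree_eq K z).mp htop
    rw [hdeg, hzm, minpoly.eq_X_sub_C, natDegree_X_sub_C] at hnat
    omega
  have hsep : (minpoly K z).Separable := by
    rw [hmin]
    refine ⟨C b⁻¹, -C b⁻¹ * X, ?_⟩
    have hCb : C b⁻¹ * C b = 1 := by rw [← C_mul, inv_mul_cancel₀ hb0, C_1]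
    have h3 : derivative (3 : K[X]) = 0 := derivative_ofNat 3
    simp only [derivative_sub, derivative_mul, derivative_X_pow, derivative_X, derivative_C, h3,
      Nat.cast_ofNat, map_ofNat]
    grind
  obtain ⟨w, hw⟩ : ∃ w : L, z ^ 2 + z * w + w ^ 2 = 1 := by
    refine ⟨(algebraMap K L b * algebraMap K L u + 1 + z) / (z + 1) ^ 2, ?_⟩
    generalize algebraMap K L b = b' at *
    generalize algebraMap K L u = u' at *
    field_simp
    grind
  have hfac : (minpoly K z).map (algebraMap K L) = (X - C z) * (X - C w) * (X - C (z + w)) := by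
    rw [hmin]
    have hb' : algebraMap K L b = z ^ 3 - 3 * z := by linear_combination -hroot
    have hwC : C z ^ 2 + C z * C w + C w ^ 2 = 1 := by simpa using congrArg C hw
    simp only [Polynomial.map_sub, Polynomial.map_pow, Polynomial.map_mul, map_X, map_C, hb',
      Polynomial.map_ofNat, map_sub, map_add, map_pow, map_mul, map_ofNat]
    grind
  have hsplit : ((minpoly K z).map (algebraMap K L)).Splits := by
    rw [hfac]
    exact ((Splits.X_sub_C z).mul (Splits.X_sub_C w)).mul (Splits.X_sub_C (z + w))
  have : (minpoly K z).IsSplittingField K L := by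
    rw [isSplittingField_iff_intermediateField]
    refine ⟨hsplit, top_unique ?_⟩
    rw [← htop]
    refine IntermediateField.adjoin.mono _ _ _ ?_
    rw [Set.singleton_subset_iff, mem_rootSet]
    exact ⟨minpoly.ne_zero (.of_finite K z), minpoly.aeval K z⟩
  exact IsGalois.of_separable_splitting_field hsep

end Galois

/-- Let F_q be a finite field with q elements of characteristic 2 with q ≡ −1 (mod 3).
A field extension L of F_q(x) of degree 3 is Galois if and only if there exists a
primitive element z of L/F_q(x) whose minimal polynomial is X^3 − 3X − b, where b = P/Q
for coprime P, Q ∈ F_q[x] of the form P = A^2 and Q = A^2 + AB + B^2 with A, B ∈ F_q[x]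
coprime. -/
theorem galois_criterion_char_two
    (F : Type*) [Field F] [Fintype F]
    [CharP F 2]
    (hq : Fintype.card F % 3 = 2)
    (L : Type*) [Field L] [Algebra (RatFunc F) L]
    (hdeg : Module.finrank (RatFunc F) L = 3) :
    IsGalois (RatFunc F) L ↔
      ∃ (z : L) (P Q A B : Polynomial F),
        IntermediateField.adjoin (RatFunc F) {z} = ⊤ ∧
        IsCoprime P Q ∧ IsCoprime A B ∧
        P = A ^ 2 ∧
        Q = A ^ 2 + A * B + B ^ 2 ∧
        minpoly (RatFunc F) z =
          X ^ 3 - 3 * X -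
            C (algebraMap (Polynomial F) (RatFunc F) P /
               algebraMap (Polynomial F) (RatFunc F) Q) := by
  constructor
  · intro _
    obtain ⟨z, u, htop, hmin⟩ := exists_minpoly_eq_of_isGalois_of_finrank_eq_three hdeg
      (RatFunc.sq_add_self_add_one_ne_zero hq)
    obtain ⟨A, B, hAB, hu⟩ := RatFunc.exists_isCoprime_inv_sq_add_self_add_one u
    exact ⟨z, _, _, A, B, htop, hAB.sq_sq_add_mul_add_sq, hAB, rfl, rfl, hu ▸ hmin⟩
  · rintro ⟨z, P, Q, A, B, htop, -, -, rfl, rfl, hmin⟩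
    have : FiniteDimensional (RatFunc F) L := Module.finite_of_finrank_pos (by omega)
    set b := algebraMap F[X] (RatFunc F) (A ^ 2) /
      algebraMap F[X] (RatFunc F) (A ^ 2 + A * B + B ^ 2) with hb
    have hb0 : b ≠ 0 := by
      intro h0
      have hz : z = 0 := by
        rw [← minpoly.coeff_zero_eq_zero (.of_finite (RatFunc F) z), hmin, h0]
        simp
      have hnat := (Field.primitive_element_iff_minpoly_natDegree_eq (RatFunc F) z).mp htop
      rw [hdeg, hz, minpoly.zero, natDegree_X] at hnat
      omega
    have hA : algebraMap F[X] (RatFunc F) A ≠ 0 := by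
      intro h
      simp [hb, h] at hb0
    have hbu : b = ((algebraMap F[X] (RatFunc F) B / algebraMap F[X] (RatFunc F) A) ^ 2 +
        algebraMap F[X] (RatFunc F) B / algebraMap F[X] (RatFunc F) A + 1)⁻¹ := by
      rw [hb, eq_comm, inv_eq_iff_eq_inv, inv_div, eq_div_iff (by simpa using hA)]
      simp only [map_add, map_mul, map_pow]
      field_simp
      ring
    refine isGalois_of_minpoly_eq hdeg htop (fun h => hb0 ?_) (hbu ▸ hmin)
    rw [hbu, h, inv_zero]
end

section
/- Let F_q be a finite field with q elements, q ≡ −1 (mod 3), and let L/F_q(x) be a Galois field extension of degree 3 with a primitive element z whose minimal polynomial is X^3 − 3X − b, where b = P/Q with P, Q ∈ F_q[x] coprime. Then every irreducible factor of Q in F_q[x] has even degree; that is, Q = w · ∏_i Q_i^{e_i} with w ∈ F_q^*, each Q_i a monic irreducible polynomial of even degree, and each e_i a positive integer. -/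
open Polynomial

theorem even_of_pow_mod_three_eq_one {q n : ℕ} (hq : q % 3 = 2) (h : q ^ n % 3 = 1) : Even n := by
  rw [Nat.pow_mod, hq] at h
  by_contra hn
  obtain ⟨m, rfl⟩ := Nat.not_even_iff_odd.mp hn
  rw [pow_add, pow_mul, Nat.mul_mod, Nat.pow_mod] at h
  norm_num at h

/-- A finite field of characteristic different from `3` containing a primitive cube root of unity
has cardinality congruent to `1` modulo `3`. -/
theorem card_mod_three_of_cube_root {k : Type*} [Field k] [Fintype k] (h3 : (3 : k) ≠ 0) {w : k}
    (hw : w ^ 2 + w + 1 = 0) : Fintype.card k % 3 = 1 := by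
  have hw3 : w ^ 3 = 1 := by linear_combination (w - 1) * hw
  have hw1 : w ≠ 1 := by
    rintro rfl
    exact h3 (by linear_combination hw)
  have hw0 : w ≠ 0 := by
    rintro rfl
    simp at hw
  have : Fact (Nat.Prime 3) := ⟨Nat.prime_three⟩
  have hord : orderOf w = 3 := orderOf_eq_prime hw3 hw1
  have hdvd : 3 ∣ Fintype.card k - 1 :=
    hord ▸ orderOf_dvd_of_pow_eq_one (FiniteField.pow_card_sub_one_eq_one w hw0)
  have := Fintype.card_pos (α := k)
  lia

/-- Over a finite field with `q ≡ 2` modulo `3` elements, an irreducible polynomial dividing a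
primitive value of the norm form `S ^ 2 + P * S + P ^ 2` has even degree. -/
theorem even_natDegree_of_dvd_norm_form {F : Type*} [Field F] [Fintype F]
    (hq : Fintype.card F % 3 = 2) (h3 : (3 : F) ≠ 0) {P R S : F[X]} (hR : Irreducible R)
    (hP : ¬ R ∣ P) (h : R ∣ S ^ 2 + P * S + P ^ 2) : Even R.natDegree := by
  have : Fact (Irreducible R) := ⟨hR⟩
  let pb := AdjoinRoot.powerBasis hR.ne_zero
  have : Module.Finite F (AdjoinRoot R) := pb.finite
  have : Finite (AdjoinRoot R) := Module.finite_of_finite F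
  let := Fintype.ofFinite (AdjoinRoot R)
  have hcard : Fintype.card (AdjoinRoot R) = Fintype.card F ^ R.natDegree := by
    rw [Module.card_eq_pow_finrank (K := F), pb.finrank, AdjoinRoot.powerBasis_dim]
  have hP' : AdjoinRoot.mk R P ≠ 0 := fun h0 => hP (AdjoinRoot.mk_eq_zero.mp h0)
  have h' := AdjoinRoot.mk_eq_zero.mpr h
  simp only [map_add, map_mul, map_pow] at h'
  have h3' : (3 : AdjoinRoot R) ≠ 0 := by
    rw [← map_ofNat (algebraMap F (AdjoinRoot R)) 3]
    exact (_root_.map_ne_zero _).mpr h3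
  refine even_of_pow_mod_three_eq_one hq (hcard ▸ card_mod_three_of_cube_root h3'
    (w := AdjoinRoot.mk R S / AdjoinRoot.mk R P) ?_)
  field_simp
  linear_combination h'

/-- A generator of the Galois group of a cubic Galois extension. -/
theorem exists_algEquiv_of_finrank_three {K L : Type*} [Field K] [Field L] [Algebra K L]
    [IsGalois K L] (hdeg : Module.finrank K L = 3) {z : L}
    (hz : IntermediateField.adjoin K {z} = ⊤) :
    ∃ σ : L ≃ₐ[K] L, σ z ≠ z ∧ (∀ y, σ (σ (σ y)) = y) ∧
      ∀ y, σ y = y → y ∈ Set.range (algebraMap K L) := by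
  have : FiniteDimensional K L := Module.finite_of_finrank_pos (by omega)
  have hcard : Nat.card (L ≃ₐ[K] L) = 3 := by rw [IsGalois.card_aut_eq_finrank, hdeg]
  have : Fact (Nat.Prime 3) := ⟨Nat.prime_three⟩
  have : Nontrivial (L ≃ₐ[K] L) := Finite.one_lt_card_iff_nontrivial.mp (by omega)
  obtain ⟨σ, hσ⟩ := exists_ne (1 : L ≃ₐ[K] L)
  have hfix : ∀ y, σ y = y → y ∈ Set.range (algebraMap K L) := by
    intro y hy
    rw [IsGalois.mem_range_algebraMap_iff_fixed]
    intro τ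
    have hτ : τ ∈ Subgroup.zpowers σ := mem_zpowers_of_prime_card hcard hσ
    have hle : Subgroup.zpowers σ ≤ MulAction.stabilizer (L ≃ₐ[K] L) y := by
      simpa using hy
    exact hle hτ
  refine ⟨σ, fun h => ?_, fun y => ?_, hfix⟩
  · obtain ⟨c, rfl⟩ := hfix z h
    have hbot : IntermediateField.adjoin K {algebraMap K L c} = ⊥ := by simp
    have := IntermediateField.finrank_top' (F := K) (E := L)
    rw [← hz, hbot, IntermediateField.finrank_bot] at this
    omega
  · have : σ ^ 3 = 1 := hcard ▸ pow_card_eq_one'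
    exact DFunLike.congr_fun this y

/-- If a root of `X ^ 3 - 3 * X - b` generates a cubic Galois extension of `K`, then its quadratic
resolvent `X ^ 2 + b * X + b ^ 2 - 3` has a root in `K`. -/
theorem exists_root_quadratic_resolvent {K L : Type*} [Field K] [Field L] [Algebra K L]
    [IsGalois K L] (h3 : (3 : K) ≠ 0) (hdeg : Module.finrank K L = 3) {z : L}
    (hz : IntermediateField.adjoin K {z} = ⊤) {b : K} (hb : z ^ 3 - 3 * z - algebraMap K L b = 0) :
    ∃ r : K, r ^ 2 + b * r + b ^ 2 - 3 = 0 := by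
  obtain ⟨σ, hσz, hσ3, hfix⟩ := exists_algEquiv_of_finrank_three hdeg hz
  set z' := σ z with hz'
  have hb' : z' ^ 3 - 3 * z' - algebraMap K L b = 0 := by
    simpa [← hz', map_ofNat σ] using congrArg σ hb
  have h1 : z' ^ 2 + z * z' + z ^ 2 - 3 = 0 := by
    refine (mul_eq_zero.mp ?_).resolve_left (sub_ne_zero.mpr hσz)
    linear_combination hb' - hb
  have h2 : (σ z') ^ 2 + z' * σ z' + z' ^ 2 - 3 = 0 := by
    simpa [← hz', map_ofNat σ] using congrArg σ h1
  have hne : σ z' - z ≠ 0 := fun h => hσz (by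
    have := hσ3 z
    rwa [← hz', sub_eq_zero.mp h] at this)
  have h4 : σ z' + z + z' = 0 := by
    refine (mul_eq_zero.mp ?_).resolve_left hne
    linear_combination h2 - h1
  obtain ⟨t, ht⟩ := hfix (z ^ 2 * z' + z' ^ 2 * σ z' + (σ z') ^ 2 * z) (by
    simp only [map_add, map_mul, map_pow, ← hz']
    rw [show σ (σ z') = z from hσ3 z]
    ring)
  rw [show σ z' = -z - z' by linear_combination h4] at ht
  have hbz : algebraMap K L b = z ^ 3 - 3 * z := by linear_combination -hb
  have key : t ^ 2 + 3 * b * t + 9 * b ^ 2 - 27 = 0 := by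
    apply (algebraMap K L).injective
    simp only [map_add, map_sub, map_mul, map_pow, map_ofNat, map_zero, ht, hbz]
    linear_combination (9 * (z ^ 2 - 1) ^ 2 - 3 * (z' - z) * (z ^ 3 - 3 * z) -
      (z' - z) * (z ^ 3 + 6 * z ^ 2 * z' - z' ^ 3 + 3 * z - 3 * z')) * h1
  refine ⟨t / 3, ?_⟩
  field_simp
  linear_combination key

/-- Let F_q be a finite field with q ≡ −1 (mod 3), and let L/F_q(x) be a Galois field
extension of degree 3 with a primitive element z whose minimal polynomial is
X^3 − 3X − b, where b = P/Q with P, Q ∈ F_q[x] coprime. Then every irreducible factor of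
Q in F_q[x] has even degree. -/
theorem denominator_factors_have_even_degree
    (F : Type*) [Field F] [Fintype F]
    (hq : Fintype.card F % 3 = 2)
    (L : Type*) [Field L] [Algebra (RatFunc F) L]
    [IsGalois (RatFunc F) L]
    (hdeg : Module.finrank (RatFunc F) L = 3)
    (z : L) (P Q : Polynomial F)
    (hz : IntermediateField.adjoin (RatFunc F) {z} = ⊤)
    (hPQ : IsCoprime P Q)
    (hmin : minpoly (RatFunc F) z =
      X ^ 3 - 3 * X -
        C (algebraMap (Polynomial F) (RatFunc F) P /
           algebraMap (Polynomial F) (RatFunc F) Q)) :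
    ∀ R : Polynomial F, Irreducible R → R ∣ Q → Even R.natDegree := by
  intro R hR hRQ
  have h3F : (3 : F) ≠ 0 := by
    intro h
    have hcard := FiniteField.cast_card_eq_zero F
    rw [← Nat.div_add_mod (Fintype.card F) 3, hq] at hcard
    push_cast at hcard
    exact one_ne_zero (α := F) (by linear_combination h - hcard + (↑(Fintype.card F / 3) : F) * h)
  have hP : ¬ R ∣ P := fun h => hR.not_isUnit (hPQ.isUnit_of_dvd' h hRQ)
  have h3 : (3 : RatFunc F) ≠ 0 := by
    rw [← map_ofNat (algebraMap F (RatFunc F)) 3]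
    exact (_root_.map_ne_zero _).mpr h3F
  have : FiniteDimensional (RatFunc F) L := Module.finite_of_finrank_pos (by omega)
  have hb := minpoly.aeval (RatFunc F) z
  rw [hmin] at hb
  simp only [map_sub, map_mul, map_pow, aeval_X, aeval_C, map_ofNat] at hb
  have hQ : Q ≠ 0 := by
    rintro rfl
    have hroot : algebraMap (RatFunc F) L 0 = z :=
      minpoly.root (Algebra.IsIntegral.isIntegral z) (by simp [hmin])
    have hone := minpoly.eq_X_sub_C L (0 : RatFunc F)
    rw [hroot, hmin] at hone
    have hdeg3 : (X ^ 3 - 3 * X - C (algebraMap F[X] (RatFunc F) P /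
        algebraMap F[X] (RatFunc F) 0)).natDegree = 3 := by
      compute_degree!
    rw [hone, natDegree_X_sub_C] at hdeg3
    omega
  have hQ' : algebraMap F[X] (RatFunc F) Q ≠ 0 := by simpa using hQ
  obtain ⟨r, hr⟩ := exists_root_quadratic_resolvent h3 hdeg hz hb
  have hint : IsIntegral F[X] (r * algebraMap F[X] (RatFunc F) Q) := by
    refine ⟨X ^ 2 + C P * X + (C P ^ 2 - 3 * C Q ^ 2), by monicity!, ?_⟩
    simp only [eval₂_add, eval₂_sub, eval₂_mul, eval₂_pow, eval₂_X, eval₂_C, eval₂_ofNat]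
    field_simp at hr
    linear_combination hr
  obtain ⟨S, hS⟩ := IsIntegrallyClosed.isIntegral_iff.mp hint
  have hSQ : S ^ 2 + P * S + P ^ 2 = 3 * Q ^ 2 := by
    apply FaithfulSMul.algebraMap_injective F[X] (RatFunc F)
    simp only [map_add, map_mul, map_pow, map_ofNat, hS]
    field_simp at hr
    linear_combination hr
  refine even_natDegree_of_dvd_norm_form hq h3F hR hP (S := S) ?_
  rw [hSQ]
  exact (dvd_pow hRQ two_ne_zero).mul_left 3
end

section
/- Let F_q be a finite field with q elements, of odd characteristic, with q ≡ −1 (mod 3). Let A, B ∈ F_q[x] be coprime, set P = 2(A^2 − 3^{-1}B^2) and Q = A^2 + 3^{-1}B^2, and assume P and Q are coprime. Let E be the quadratic extension field of F_q (so E is a field with q^2 elements containing F_q) and let t ∈ E satisfy t^2 = −3^{-1}. Then the polynomial X^3 − 3X − P/Q is reducible over F_q(x) if and only if the polynomial A + tB ∈ E[x] (where A and B are viewed in E[x] via the inclusion F_q[x] ⊆ E[x]) is the cube of a polynomial in E[x]. -/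
open Polynomial

/-- If `w + w⁻¹` is the value of the Dickson polynomial `X ^ 3 - 3 X` at `r`, then `w` is a cube. -/
lemma exists_pow_three_eq_of_dickson {K : Type*} [Field K] (h2 : (2 : K) ≠ 0) {r w : K}
    (hw : w ≠ 0) (h : r ^ 3 - 3 * r = w + w⁻¹) : ∃ u : K, u ^ 3 = w := by
  have hwi : w * w⁻¹ = 1 := mul_inv_cancel₀ hw
  generalize w⁻¹ = v at h hwi
  by_cases hr : r ^ 2 - 1 = 0
  · have hsq : (w + r) ^ 2 = 0 := by
      linear_combination (-w) * h - hwi + (w * r + 1) * hr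
    have hwr : w + r = 0 := by simpa using hsq
    exact ⟨-r, by linear_combination (-r) * hr - hwr⟩
  · set k := (w - v) / (r ^ 2 - 1) with hk
    have hk1 : k * (r ^ 2 - 1) = w - v := div_mul_cancel₀ _ hr
    have hk2 : k ^ 2 = r ^ 2 - 4 := by
      apply mul_right_cancel₀ (pow_ne_zero 2 hr)
      linear_combination (k * (r ^ 2 - 1) + w - v) * hk1 - (r ^ 3 - 3 * r + w + v) * h - 4 * hwi
    refine ⟨(r + k) / 2, ?_⟩
    have h8 : (8 : K) ≠ 0 := by
      have : (8 : K) = 2 ^ 3 := by norm_num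
      rw [this]; exact pow_ne_zero 3 h2
    have key : (r + k) ^ 3 = 8 * w := by
      linear_combination (3 * r + k) * hk2 + 4 * hk1 + 4 * h
    rw [div_pow, key]
    field_simp
    norm_num

/-- Over a field, if the quotient of two coprime polynomials is a cube of a rational function, then
both are cubes up to a common constant. -/
lemma exists_C_mul_pow_three_of_isCoprime {E : Type*} [Field E] {a b : E[X]} (hab : IsCoprime a b)
    (hb : b ≠ 0) {u : RatFunc E}
    (hu : u ^ 3 = algebraMap E[X] (RatFunc E) a / algebraMap E[X] (RatFunc E) b) :
    ∃ (c : E) (n d : E[X]), a = C c * n ^ 3 ∧ b = C c * d ^ 3 := by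
  have hd : u.denom ≠ 0 := u.denom_ne_zero
  have hcop : IsCoprime (u.num ^ 3) (u.denom ^ 3) := (RatFunc.isCoprime_num_denom u).pow
  have heq : a * u.denom ^ 3 = b * u.num ^ 3 := by
    apply RatFunc.algebraMap_injective E
    have hb' : algebraMap E[X] (RatFunc E) b ≠ 0 := RatFunc.algebraMap_ne_zero hb
    have hd' : algebraMap E[X] (RatFunc E) u.denom ≠ 0 := RatFunc.algebraMap_ne_zero hd
    rw [← RatFunc.num_div_denom u] at hu
    rw [div_pow, div_eq_div_iff (pow_ne_zero 3 hd') hb'] at hu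
    simp only [map_mul, map_pow]
    linear_combination -hu
  have h1 : b ∣ u.denom ^ 3 := hab.symm.dvd_of_dvd_mul_left ⟨_, heq⟩
  have h2 : u.denom ^ 3 ∣ b :=
    hcop.symm.dvd_of_dvd_mul_right ⟨a, by rw [← heq, mul_comm]⟩
  obtain ⟨v, hv⟩ := associated_of_dvd_dvd h2 h1
  obtain ⟨c, -, hc⟩ := Polynomial.isUnit_iff.1 v.isUnit
  rw [← hc] at hv
  refine ⟨c, u.num, u.denom, ?_, by rw [← hv, mul_comm]⟩
  apply mul_right_cancel₀ (pow_ne_zero 3 hd)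
  rw [heq, ← hv]
  ring

lemma three_ne_zero_of_card_mod_three (F : Type*) [Field F] [Fintype F]
    (hq : Fintype.card F % 3 = 2) : (3 : F) ≠ 0 := by
  intro h3
  have h := FiniteField.cast_card_eq_zero F
  rw [← Nat.div_add_mod (Fintype.card F) 3, hq] at h
  push_cast at h
  rw [h3, zero_mul, zero_add] at h
  exact one_ne_zero (α := F) (by linear_combination h3 - h)

section QuadraticExtension

variable {F E : Type*} [Field F] [Fintype F] [Field E] [Algebra F E]

lemma pow_card_eq_neg_of_sq_eq (h2 : (2 : F) ≠ 0) (hq : Fintype.card F % 3 = 2)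
    {t : E} (ht : t ^ 2 = -(3 : E)⁻¹) : t ^ Fintype.card F = -t := by
  have h3 : (3 : E) ≠ 0 :=
    map_ofNat (algebraMap F E) 3 ▸ (_root_.map_ne_zero _).2 (three_ne_zero_of_card_mod_three F hq)
  have h2' : (2 : E) ≠ 0 := map_ofNat (algebraMap F E) 2 ▸ (_root_.map_ne_zero _).2 h2
  have ht' : 3 * t ^ 2 = -1 := by rw [ht]; field_simp
  set σ := FiniteField.frobeniusAlgHom F E with hσ
  have hσa : ∀ x, σ x = x ^ Fintype.card F := fun x => rfl
  rw [← hσa]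
  set w : E := (3 * t - 1) / 2 with hw
  have hw1 : 2 * w = 3 * t - 1 := by rw [hw]; field_simp
  have hw2 : w ^ 2 + w + 1 = 0 := by
    apply mul_left_cancel₀ (pow_ne_zero 2 h2')
    linear_combination (2 * w + 3 * t + 1) * hw1 + 3 * ht'
  have hw3 : w ^ 3 = 1 := by linear_combination (w - 1) * hw2
  have hσw : σ w = w ^ 2 := by
    rw [hσa, ← Nat.div_add_mod (Fintype.card F) 3, hq, pow_add, pow_mul, hw3, one_pow, one_mul]
  have h := congrArg σ hw1
  simp only [map_mul, map_sub, map_one, map_ofNat, hσw] at h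
  apply mul_left_cancel₀ h3
  linear_combination -h + 2 * hw2 - hw1

lemma eq_zero_of_add_mul_eq_zero (h2 : (2 : F) ≠ 0) (hq : Fintype.card F % 3 = 2)
    {t : E} (ht : t ^ 2 = -(3 : E)⁻¹) {a b : F}
    (h : algebraMap F E a + t * algebraMap F E b = 0) : a = 0 ∧ b = 0 := by
  have h2' : (2 : E) ≠ 0 := map_ofNat (algebraMap F E) 2 ▸ (_root_.map_ne_zero _).2 h2
  have h3 : (3 : E) ≠ 0 :=
    map_ofNat (algebraMap F E) 3 ▸ (_root_.map_ne_zero _).2 (three_ne_zero_of_card_mod_three F hq)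
  have ht0 : t ≠ 0 := by
    rintro rfl
    simp [h3] at ht
  have h' := congrArg (FiniteField.frobeniusAlgHom F E) h
  rw [map_add, map_mul, map_zero, AlgHom.commutes, AlgHom.commutes,
    FiniteField.frobeniusAlgHom_apply, pow_card_eq_neg_of_sq_eq h2 hq ht] at h'
  have ha : algebraMap F E a = 0 := by
    apply mul_left_cancel₀ h2'
    linear_combination h + h'
  have hb : algebraMap F E b = 0 := by
    apply mul_left_cancel₀ ht0
    linear_combination h - ha
  exact ⟨by simpa using ha, by simpa using hb⟩

lemma Polynomial.eq_zero_of_map_add_mul_map_eq_zero (h2 : (2 : F) ≠ 0)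
    (hq : Fintype.card F % 3 = 2) {t : E} (ht : t ^ 2 = -(3 : E)⁻¹) {a b : F[X]}
    (h : a.map (algebraMap F E) + C t * b.map (algebraMap F E) = 0) : a = 0 ∧ b = 0 := by
  have hc (n : ℕ) : a.coeff n = 0 ∧ b.coeff n = 0 :=
    eq_zero_of_add_mul_eq_zero h2 hq ht (by simpa using congrArg (coeff · n) h)
  exact ⟨Polynomial.ext fun n => (hc n).1, Polynomial.ext fun n => (hc n).2⟩

lemma Polynomial.exists_eq_map_add_mul_map [Fintype E] (h2 : (2 : F) ≠ 0)
    (hq : Fintype.card F % 3 = 2) (hE : Fintype.card E = Fintype.card F ^ 2)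
    {t : E} (ht : t ^ 2 = -(3 : E)⁻¹) (U : E[X]) :
    ∃ a b : F[X], U = a.map (algebraMap F E) + C t * b.map (algebraMap F E) := by
  have hinj : Function.Injective
      fun p : F × F => algebraMap F E p.1 + t * algebraMap F E p.2 := by
    rintro ⟨a, b⟩ ⟨c, d⟩ h
    obtain ⟨h₁, h₂⟩ := eq_zero_of_add_mul_eq_zero h2 hq ht (a := a - c) (b := b - d) (by
      simp only [map_sub]
      linear_combination h)
    rw [sub_eq_zero.1 h₁, sub_eq_zero.1 h₂]
  have hsurj := ((Fintype.bijective_iff_injective_and_card _).2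
    ⟨hinj, by rw [Fintype.card_prod, hE, sq]⟩).2
  induction U using Polynomial.induction_on' with
  | add p q hp hq =>
    obtain ⟨a, b, rfl⟩ := hp
    obtain ⟨c, d, rfl⟩ := hq
    refine ⟨a + c, b + d, ?_⟩
    simp only [Polynomial.map_add]
    ring
  | monomial n e =>
    obtain ⟨⟨a, b⟩, rfl⟩ := hsurj e
    refine ⟨monomial n a, monomial n b, ?_⟩
    simp [C_mul_monomial]

/-- A polynomial of the form `c * n ^ 3` whose Frobenius conjugate is `c * d ^ 3` is a cube. -/
lemma Polynomial.exists_eq_pow_three_of_map_frobenius (hq : Fintype.card F % 3 = 2)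
    {c : E} {n d : E[X]} (hc : c ≠ 0) (hn : n ≠ 0)
    (h : (C c * n ^ 3).map (FiniteField.frobeniusAlgHom F E : E →+* E) = C c * d ^ 3) :
    ∃ U : E[X], C c * n ^ 3 = U ^ 3 := by
  have hlead := congrArg leadingCoeff h
  simp only [leadingCoeff_map, leadingCoeff_mul, leadingCoeff_C, leadingCoeff_pow, map_mul,
    map_pow, RingHom.coe_coe, FiniteField.frobeniusAlgHom_apply] at hlead
  have hm : n.leadingCoeff ^ Fintype.card F ≠ 0 := pow_ne_zero _ (leadingCoeff_ne_zero.2 hn)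
  generalize n.leadingCoeff ^ Fintype.card F = m at hlead hm
  generalize d.leadingCoeff = l at hlead
  rw [← Nat.div_add_mod (Fintype.card F) 3, hq] at hlead
  generalize Fintype.card F / 3 = k at hlead
  have hcube : c = (l / (c ^ k * m)) ^ 3 := by
    rw [div_pow, eq_div_iff (pow_ne_zero 3 (mul_ne_zero (pow_ne_zero k hc) hm))]
    apply mul_left_cancel₀ hc
    rw [← hlead]
    ring
  exact ⟨C (l / (c ^ k * m)) * n, by rw [mul_pow, ← C_pow, ← hcube]⟩

end QuadraticExtension

lemma not_irreducible_dickson_iff {K : Type*} [Field K] (s : K) :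
    ¬ Irreducible (X ^ 3 - 3 * X - C s : K[X]) ↔ ∃ r : K, r ^ 3 - 3 * r = s := by
  have hrw : (X ^ 3 - 3 * X - C s : K[X]) = X ^ 3 - (C 3 * X + C s) := by
    rw [show (C 3 : K[X]) = 3 from map_ofNat C 3]
    ring
  have hlt : (C 3 * X + C s : K[X]).degree < 3 :=
    degree_linear_le.trans_lt (by norm_num)
  have hmonic : (X ^ 3 - 3 * X - C s : K[X]).Monic := by
    rw [hrw]
    exact monic_X_pow_sub hlt
  have hdeg : (X ^ 3 - 3 * X - C s : K[X]).natDegree = 3 := by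
    rw [hrw]
    exact natDegree_eq_of_degree_eq_some (by
      rw [degree_sub_eq_left_of_degree_lt (by simpa using hlt), degree_X_pow])
  rw [hmonic.irreducible_iff_roots_eq_zero_of_degree_le_three (by omega) (by omega),
    Multiset.eq_zero_iff_forall_notMem]
  push Not
  refine exists_congr fun r => ?_
  rw [mem_roots hmonic.ne_zero]
  simp [IsRoot, sub_eq_zero]

/-- Let F_q be a finite field with q elements, of odd characteristic, with
q ≡ −1 (mod 3). Let A, B ∈ F_q[x] be coprime, set P = 2(A^2 − 3⁻¹B^2) and
Q = A^2 + 3⁻¹B^2, and assume P and Q are coprime. Let E be the quadratic extension of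
F_q (a field with q^2 elements containing F_q) and let t ∈ E satisfy t^2 = −3⁻¹. Then
X^3 − 3X − P/Q is reducible over F_q(x) if and only if A + tB is a cube in E[x]. -/
theorem reducibility_criterion
    (F : Type*) [Field F] [Fintype F]
    (hchar : ringChar F ≠ 2)
    (hq : Fintype.card F % 3 = 2)
    (A B : Polynomial F) (hAB : IsCoprime A B)
    (P Q : Polynomial F)
    (hP : P = 2 * (A ^ 2 - Polynomial.C (3 : F)⁻¹ * B ^ 2))
    (hQ : Q = A ^ 2 + Polynomial.C (3 : F)⁻¹ * B ^ 2)
    (hPQ : IsCoprime P Q)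
    (E : Type*) [Field E] [Fintype E] [Algebra F E]
    (hE : Fintype.card E = Fintype.card F ^ 2)
    (t : E) (ht : t ^ 2 = -(3 : E)⁻¹) :
    ¬ Irreducible
        ((X ^ 3 - 3 * X -
          C (algebraMap (Polynomial F) (RatFunc F) P /
             algebraMap (Polynomial F) (RatFunc F) Q)) : Polynomial (RatFunc F)) ↔
      ∃ U : Polynomial E,
        A.map (algebraMap F E) + Polynomial.C t * B.map (algebraMap F E) = U ^ 3 := by
  have h2 : (2 : F) ≠ 0 := Ring.two_ne_zero hchar
  have h3 : (3 : F) ≠ 0 := three_ne_zero_of_card_mod_three F hq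
  have h2E : (2 : E) ≠ 0 := map_ofNat (algebraMap F E) 2 ▸ (_root_.map_ne_zero _).2 h2
  have h3E : (3 : E) ≠ 0 := map_ofNat (algebraMap F E) 3 ▸ (_root_.map_ne_zero _).2 h3
  have hCt : (C t : E[X]) ^ 2 = -C (3 : E)⁻¹ := by rw [← C_pow, ht, C_neg]
  have hC3 : (3 : F[X]) * C (3 : F)⁻¹ = 1 := by
    rw [show (3 : F[X]) = C 3 from (map_ofNat C 3).symm, ← C_mul, mul_inv_cancel₀ h3, C_1]
  have hC3E : (3 : E[X]) * C (3 : E)⁻¹ = 1 := by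
    rw [show (3 : E[X]) = C 3 from (map_ofNat C 3).symm, ← C_mul, mul_inv_cancel₀ h3E, C_1]
  set φ : F[X] →+* E[X] := mapRingHom (algebraMap F E) with hφ
  have hφa (p : F[X]) : p.map (algebraMap F E) = φ p := rfl
  have hφC : φ (C (3 : F)⁻¹) = C (3 : E)⁻¹ := by
    rw [← hφa, map_C, map_inv₀, map_ofNat]
  have hφP : φ P = (φ A + C t * φ B) ^ 2 + (φ A - C t * φ B) ^ 2 := by
    rw [hP]
    simp only [map_mul, map_sub, map_pow, map_ofNat, hφC]
    linear_combination (-2 * φ B ^ 2) * hCt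
  have hφQ : φ Q = (φ A + C t * φ B) * (φ A - C t * φ B) := by
    rw [hQ]
    simp only [map_mul, map_add, map_pow, hφC]
    linear_combination φ B ^ 2 * hCt
  set σ : E →+* E := (FiniteField.frobeniusAlgHom F E : E →+* E) with hσ
  have hσφ (p : F[X]) : (φ p).map σ = φ p := by
    rw [← hφa, Polynomial.map_map]
    congr 1
    ext x
    exact (FiniteField.frobeniusAlgHom F E).commutes x
  have hσt : σ t = -t := pow_card_eq_neg_of_sq_eq h2 hq ht
  have hconj : (φ A + C t * φ B).map σ = φ A - C t * φ B := by
    simp only [Polynomial.map_add, Polynomial.map_mul, hσφ, map_C, hσt, C_neg]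
    ring
  have hα : φ A + C t * φ B ≠ 0 := by
    intro h
    obtain ⟨rfl, rfl⟩ := Polynomial.eq_zero_of_map_add_mul_map_eq_zero h2 hq ht h
    exact not_isCoprime_zero_zero hAB
  have hβ : φ A - C t * φ B ≠ 0 := by
    rw [← hconj]
    exact (Polynomial.map_ne_zero_iff σ.injective).2 hα
  have hQ0 : Q ≠ 0 := by
    rintro rfl
    rw [map_zero] at hφQ
    exact mul_ne_zero hα hβ hφQ.symm
  rw [not_irreducible_dickson_iff, hφa, hφa]
  constructor
  · rintro ⟨r, hr⟩
    have hcop : IsCoprime (φ A + C t * φ B) (φ A - C t * φ B) := by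
      obtain ⟨u, v, huv⟩ := hAB.map φ
      have hhalf : (2 : E[X]) * C (2 : E)⁻¹ = 1 := by
        rw [show (2 : E[X]) = C 2 from (map_ofNat C 2).symm, ← C_mul, mul_inv_cancel₀ h2E, C_1]
      refine ⟨C (2 : E)⁻¹ * (u - 3 * C t * v), C (2 : E)⁻¹ * (u + 3 * C t * v), ?_⟩
      linear_combination huv + (u * φ A - 3 * C t ^ 2 * v * φ B) * hhalf
        - 3 * v * φ B * hCt + v * φ B * hC3E
    set n := φ r.num with hn
    set d := φ r.denom with hd
    have hd0 : d ≠ 0 := (Polynomial.map_ne_zero_iff (algebraMap F E).injective).2 r.denom_ne_zero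
    have hpoly : (n ^ 3 - 3 * n * d ^ 2) * φ Q = φ P * d ^ 3 := by
      rw [hn, hd, ← map_pow, ← map_pow, ← map_pow, ← map_mul, ← map_ofNat φ, ← map_mul, ← map_mul,
        ← map_sub, ← map_mul]
      congr 1
      apply RatFunc.algebraMap_injective F
      have hd' : algebraMap F[X] (RatFunc F) r.denom ≠ 0 :=
        RatFunc.algebraMap_ne_zero r.denom_ne_zero
      have hQ' : algebraMap F[X] (RatFunc F) Q ≠ 0 := RatFunc.algebraMap_ne_zero hQ0
      rw [← RatFunc.num_div_denom r] at hr
      simp only [map_mul, map_sub, map_pow, map_ofNat]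
      field_simp at hr
      linear_combination hr
    rw [hφP, hφQ] at hpoly
    have hα' := RatFunc.algebraMap_ne_zero hα
    have hβ' := RatFunc.algebraMap_ne_zero hβ
    have hd' := RatFunc.algebraMap_ne_zero hd0
    have h2R : (2 : RatFunc E) ≠ 0 :=
      map_ofNat (algebraMap E (RatFunc E)) 2 ▸ (_root_.map_ne_zero _).2 h2E
    obtain ⟨u, hu⟩ := exists_pow_three_eq_of_dickson h2R
      (r := algebraMap E[X] (RatFunc E) n / algebraMap E[X] (RatFunc E) d)
      (div_ne_zero hα' hβ') (by
        have h := congrArg (algebraMap E[X] (RatFunc E)) hpoly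
        rw [map_mul, map_mul _ _ (φ A - C t * φ B), map_mul _ _ (d ^ 3), map_add _ (_ ^ 2)] at h
        simp only [map_sub _ (n ^ 3), map_mul _ _ (d ^ 2), map_mul _ _ n, map_pow, map_ofNat] at h
        rw [inv_div]
        field_simp
        linear_combination h)
    obtain ⟨c, n', d', hαc, hβc⟩ := exists_C_mul_pow_three_of_isCoprime hcop hβ hu
    rw [hαc, hβc] at hconj
    rw [hαc]
    refine Polynomial.exists_eq_pow_three_of_map_frobenius hq ?_ ?_ hconj
    · rintro rfl
      exact hα (by rw [hαc, C_0, zero_mul])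
    · rintro rfl
      exact hα (by rw [hαc, zero_pow three_ne_zero, mul_zero])
  · rintro ⟨U, hU⟩
    obtain ⟨a, b, rfl⟩ := Polynomial.exists_eq_map_add_mul_map h2 hq hE ht U
    rw [hφa, hφa] at hU
    obtain ⟨hA, hB⟩ := Polynomial.eq_zero_of_map_add_mul_map_eq_zero h2 hq ht
      (a := A - (a ^ 3 - a * b ^ 2)) (b := B - (3 * a ^ 2 * b - C (3 : F)⁻¹ * b ^ 3)) (by
        simp only [hφa, map_sub, map_mul, map_pow, map_ofNat, hφC]
        linear_combination hU + (3 * φ a * φ b ^ 2 + C t * φ b ^ 3) * hCt - φ a * φ b ^ 2 * hC3E)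
    rw [sub_eq_zero] at hA hB
    set q := a ^ 2 + C (3 : F)⁻¹ * b ^ 2 with hqdef
    set p := 2 * (a ^ 2 - C (3 : F)⁻¹ * b ^ 2) with hpdef
    have hQq : Q = q ^ 3 := by
      rw [hQ, hA, hB, hqdef]
      linear_combination
        (2 * a ^ 4 * b ^ 2 - a ^ 2 * b ^ 4 * (3 * C (3 : F)⁻¹ + 1)) * hC3
    have hPp : P = p ^ 3 - 3 * p * q ^ 2 := by
      rw [hP, hA, hB, hqdef, hpdef]
      linear_combination
        (4 * a ^ 4 * b ^ 2 - 2 * a ^ 2 * b ^ 4 * (3 * C (3 : F)⁻¹ + 1)) * hC3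
    have hq0 : q ≠ 0 := by
      intro h
      exact hQ0 (by rw [hQq, h, zero_pow three_ne_zero])
    have hq0' : algebraMap F[X] (RatFunc F) q ≠ 0 := RatFunc.algebraMap_ne_zero hq0
    refine ⟨algebraMap F[X] (RatFunc F) p / algebraMap F[X] (RatFunc F) q, ?_⟩
    rw [hQq, hPp]
    simp only [map_sub, map_mul, map_pow, map_ofNat]
    field_simp
end

section
/- Let K be a field of characteristic different from 3 that contains no primitive third root of unity (i.e., no ξ ∈ K satisfies ξ^2 + ξ + 1 = 0). Let L/K be a Galois field extension of degree 3 and let z be a primitive element of L/K with minimal polynomial X^3 − 3X − a over K (so a ∈ K and a ≠ 0, since this polynomial is irreducible). Then there exists f ∈ K satisfying (1 − 4/a^2)f^2 + (1 − 4/a^2)f + (1 − 1/a^2) = 0, and a generator σ of Gal(L/K) such that σ(z) = −((1 + 2f)/a)·z^2 + f·z + 2(1 + 2f)/a and σ^2(z) = ((1 + 2f)/a)·z^2 + (−1 − f)·z − 2(1 + 2f)/a. -/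
open Polynomial

/-- If the minimal polynomial of `z` has degree at least three, then `1`, `z`, `z ^ 2` are
linearly independent. -/
lemma coeffs_eq_zero_of_three_le_natDegree_minpoly {K L : Type*} [Field K] [Field L]
    [Algebra K L] {z : L} (hz : 3 ≤ (minpoly K z).natDegree) {p q r : K}
    (h : algebraMap K L p * z ^ 2 + algebraMap K L q * z + algebraMap K L r = 0) :
    p = 0 ∧ q = 0 ∧ r = 0 := by
  have hP : C p * X ^ 2 + C q * X + C r = (0 : K[X]) := by
    by_contra hne
    have := natDegree_le_natDegree (minpoly.degree_le_of_ne_zero K z hne (by simpa using h))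
    have := natDegree_quadratic_le (a := p) (b := q) (c := r)
    omega
  refine ⟨?_, ?_, ?_⟩
  · simpa [coeff_X, coeff_C] using congrArg (coeff · 2) hP
  · simpa [coeff_X, coeff_C] using congrArg (coeff · 1) hP
  · simpa [coeff_X, coeff_C] using congrArg (coeff · 0) hP

/-- If `L = K(z)` and the minimal polynomial of `z` has degree three, then `1`, `z`, `z ^ 2`
span `L` over `K`. -/
lemma exists_eq_quadratic_of_adjoin_eq_top {K L : Type*} [Field K] [Field L] [Algebra K L]
    {z : L} (hz : IntermediateField.adjoin K {z} = ⊤) (hdeg : (minpoly K z).natDegree = 3)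
    (w : L) :
    ∃ e f g : K, w = algebraMap K L e * z ^ 2 + algebraMap K L f * z + algebraMap K L g := by
  have hint : IsIntegral K z := by
    by_contra h
    simp [minpoly.eq_zero h] at hdeg
  have hw : w ∈ Algebra.adjoin K {z} := by
    rw [← IntermediateField.adjoin_simple_toSubalgebra_of_isAlgebraic hint.isAlgebraic, hz]
    trivial
  obtain ⟨p, rfl⟩ := Algebra.adjoin_mem_exists_aeval K z hw
  have hlt : (p %ₘ minpoly K z).natDegree < 3 :=
    hdeg ▸ natDegree_modByMonic_lt p (minpoly.monic hint) (minpoly.ne_one K z)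
  refine ⟨(p %ₘ minpoly K z).coeff 2, (p %ₘ minpoly K z).coeff 1, (p %ₘ minpoly K z).coeff 0, ?_⟩
  rw [← aeval_modByMonic_eq_self_of_root (minpoly.aeval K z), aeval_eq_sum_range' hlt]
  simp [Finset.sum_range_succ, Algebra.smul_def]
  ring

/-- An automorphism fixing a primitive element is trivial. -/
lemma AlgEquiv.eq_one_of_adjoin_eq_top {K L : Type*} [Field K] [Field L] [Algebra K L]
    {z : L} (hz : IntermediateField.adjoin K {z} = ⊤) {σ : L ≃ₐ[K] L} (h : σ z = z) :
    σ = 1 := by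
  have hfix : IntermediateField.adjoin K {z} ≤
      IntermediateField.fixedField (Subgroup.zpowers σ) := by
    rw [IntermediateField.le_iff_le, Subgroup.zpowers_le, IntermediateField.mem_fixingSubgroup_iff]
    intro x hx
    induction hx using IntermediateField.adjoin_induction with
    | mem x hx => rw [Set.mem_singleton_iff.mp hx]; exact h
    | algebraMap x => simp
    | add x y _ _ hx hy => simp_all
    | inv x _ hx => simp_all
    | mul x y _ _ hx hy => simp_all
  ext x
  have hx : x ∈ IntermediateField.fixedField (Subgroup.zpowers σ) := hfix (hz ▸ trivial)
  exact hx ⟨σ, Subgroup.mem_zpowers σ⟩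

/-- Let K be a field of characteristic different from 3 containing no primitive third
root of unity. Let L/K be a Galois field extension of degree 3 and let z be a primitive
element of L/K with minimal polynomial X^3 − 3X − a over K. Then there exists f ∈ K
satisfying (1 − 4/a^2)f^2 + (1 − 4/a^2)f + (1 − 1/a^2) = 0 and a generator σ of
Gal(L/K) such that σ(z) = −((1 + 2f)/a)z^2 + fz + 2(1 + 2f)/a and
σ^2(z) = ((1 + 2f)/a)z^2 + (−1 − f)z − 2(1 + 2f)/a. -/
theorem galois_action_on_standard_generator
    (K L : Type*) [Field K] [Field L] [Algebra K L]
    (hchar : ringChar K ≠ 3)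
    (hroot : ¬ ∃ ξ : K, ξ ^ 2 + ξ + 1 = 0)
    [IsGalois K L]
    (hdeg : Module.finrank K L = 3)
    (z : L) (a : K)
    (hz : IntermediateField.adjoin K {z} = ⊤)
    (hmin : minpoly K z = X ^ 3 - 3 * X - C a) :
    ∃ (f : K) (σ : L ≃ₐ[K] L),
      (1 - 4 / a ^ 2) * f ^ 2 + (1 - 4 / a ^ 2) * f + (1 - 1 / a ^ 2) = 0 ∧
      Subgroup.zpowers σ = ⊤ ∧
      σ z = -(algebraMap K L ((1 + 2 * f) / a)) * z ^ 2 + algebraMap K L f * z +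
        algebraMap K L (2 * (1 + 2 * f) / a) ∧
      σ (σ z) = algebraMap K L ((1 + 2 * f) / a) * z ^ 2 + algebraMap K L (-1 - f) * z -
        algebraMap K L (2 * (1 + 2 * f) / a) := by
  have h3 : (3 : K) ≠ 0 := fun h =>
    hchar (CharP.ringChar_of_prime_eq_zero Nat.prime_three (by exact_mod_cast h))
  have hnat : (minpoly K z).natDegree = 3 := by
    rw [hmin, show (X ^ 3 - 3 * X - C a : K[X]) = C 1 * X ^ 3 + C 0 * X ^ 2 + C (-3) * X + C (-a) by
      simp [show (C 3 : K[X]) = 3 from map_ofNat C 3]; ring]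
    exact natDegree_cubic one_ne_zero
  have hint : IsIntegral K z := by
    by_contra h
    simp [minpoly.eq_zero h] at hnat
  have ha : a ≠ 0 := by
    rintro rfl
    refine minpoly.coeff_zero_ne_zero hint ?_ (by simp [hmin])
    rintro rfl
    simp [minpoly.zero] at hnat
  have hroot_z : z ^ 3 = 3 * z + algebraMap K L a := by
    have := minpoly.aeval K z
    rw [hmin] at this
    simp only [map_sub, map_mul, map_pow, aeval_X, aeval_C, map_ofNat] at this
    linear_combination this
  have hcard : Nat.card (L ≃ₐ[K] L) = 3 := by
    have : FiniteDimensional K L := Module.finite_of_finrank_pos (by omega)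
    rw [IsGalois.card_aut_eq_finrank, hdeg]
  have : Finite (L ≃ₐ[K] L) := Nat.finite_of_card_ne_zero (by omega)
  have : Nontrivial (L ≃ₐ[K] L) := Finite.one_lt_card_iff_nontrivial.mp (by omega)
  obtain ⟨σ, hσ⟩ := exists_ne (1 : L ≃ₐ[K] L)
  have : Fact (Nat.Prime 3) := ⟨Nat.prime_three⟩
  have hgen : Subgroup.zpowers σ = ⊤ := zpowers_eq_top_of_prime_card hcard hσ
  have horder : orderOf σ = 3 := orderOf_eq_prime (hcard ▸ pow_card_eq_one') hσ
  have hσz : σ z ≠ z := fun h => hσ (AlgEquiv.eq_one_of_adjoin_eq_top hz h)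
  have hσσz : σ (σ z) ≠ z := fun h => by
    have h2 : σ ^ 2 = 1 := AlgEquiv.eq_one_of_adjoin_eq_top hz (by rw [pow_two]; exact h)
    have := Nat.le_of_dvd two_pos (orderOf_dvd_of_pow_eq_one h2)
    omega
  have hroot_σz : σ z ^ 3 = 3 * σ z + algebraMap K L a := by
    simpa [map_ofNat σ 3] using congrArg σ hroot_z
  have hquad : σ z ^ 2 + z * σ z + z ^ 2 - 3 = 0 :=
    mul_left_cancel₀ (sub_ne_zero.mpr hσz) (by linear_combination hroot_σz - hroot_z)
  have hquad' : σ (σ z) ^ 2 + σ z * σ (σ z) + σ z ^ 2 - 3 = 0 := by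
    simpa [map_ofNat σ 3] using congrArg σ hquad
  have htrace : σ (σ z) + z + σ z = 0 :=
    mul_left_cancel₀ (sub_ne_zero.mpr hσσz) (by linear_combination hquad' - hquad)
  obtain ⟨e, f, g, hw⟩ := exists_eq_quadratic_of_adjoin_eq_top hz hnat (σ z)
  have hu : σ (σ z) = algebraMap K L e * σ z ^ 2 + algebraMap K L f * σ z + algebraMap K L g := by
    simpa using congrArg σ hw
  have hv : z = algebraMap K L e * σ (σ z) ^ 2 + algebraMap K L f * σ (σ z) +
      algebraMap K L g := by
    have h1 : σ (σ (σ z)) + σ z + σ (σ z) = 0 := by simpa using congrArg σ htrace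
    have h2 : σ (σ (σ z)) = algebraMap K L e * σ (σ z) ^ 2 + algebraMap K L f * σ (σ z) +
      algebraMap K L g := by simpa using congrArg σ hu
    linear_combination htrace - h1 + h2
  have hg : g = -2 * e := by
    have h : algebraMap K L (3 * (g + 2 * e)) = 0 := by
      simp only [map_mul, map_add, map_ofNat]
      linear_combination (1 - algebraMap K L f) * htrace - hw - hu - hv
        - algebraMap K L e * (σ (σ z) - z - σ z) * htrace - 2 * algebraMap K L e * hquad
    have := (mul_eq_zero.mp ((map_eq_zero _).mp h)).resolve_left h3
    linear_combination this
  subst hg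
  obtain ⟨h₂, h₁, h₀⟩ := coeffs_eq_zero_of_three_le_natDegree_minpoly hnat.ge
    (p := f ^ 2 + f + 1 - e ^ 2) (q := e * (a * e + (1 + 2 * f)))
    (r := 4 * e ^ 2 + 2 * a * e * f + a * e - 3) (by
      rw [hw] at hquad
      simp only [map_mul, map_add, map_sub, map_pow, map_neg, map_one, map_ofNat] at hquad ⊢
      linear_combination hquad - (algebraMap K L e ^ 2 * z
        + 2 * algebraMap K L e * algebraMap K L f + algebraMap K L e) * hroot_z)
  have he : e ≠ 0 := by
    rintro rfl
    exact hroot ⟨f, by linear_combination h₂⟩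
  have hae := (mul_eq_zero.mp h₁).resolve_left he
  have he' : e = -((1 + 2 * f) / a) := by
    field_simp
    linear_combination hae
  have hf : algebraMap K L ((1 + 2 * f) / a) = -algebraMap K L e := by
    rw [he', map_neg, neg_neg]
  have hf' : algebraMap K L (2 * (1 + 2 * f) / a) = -2 * algebraMap K L e := by
    rw [mul_div_assoc, map_mul, hf, map_ofNat]
    ring
  refine ⟨f, σ, ?_, hgen, ?_, ?_⟩
  · rw [he'] at h₂
    linear_combination h₂
  · rw [hf, hf', hw]
    simp only [map_mul, map_neg, map_ofNat]
    ring
  · rw [hf, hf']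
    simp only [map_mul, map_neg, map_ofNat, map_sub, map_one] at hw ⊢
    linear_combination htrace - hw
end

section
/- Let K be a field of characteristic different from 3 that contains no primitive third root of unity (i.e., no ξ ∈ K satisfies ξ^2 + ξ + 1 = 0). Let Ω be a field extension of K and let z_1, z_2 ∈ Ω be such that, for i = 1, 2, the subfield K(z_i) of Ω is a Galois (hence cyclic) extension of K of degree 3 and z_i^3 − 3z_i = a_i ∈ K. Then K(z_1) = K(z_2) if and only if there exist φ, χ ∈ K with χ^2 + a_1·φ·χ + φ^2 = 1 and z_2 = φ·z_1^2 + χ·z_1 − 2φ. Moreover, for any such φ, χ one has a_2 = (−2 + a_1^2)·φ^3 + 3a_1·φ^2·χ + 6φ·χ^2 + a_1·χ^3. -/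
open Polynomial IntermediateField

/-- An element of degree `3` over `K` is not a root of a nonzero polynomial of degree at most `2`. -/
theorem coeffs_eq_zero_of_finrank_adjoin_eq_three {K Ω : Type*} [Field K] [Field Ω] [Algebra K Ω]
    {z : Ω} (hz : IsIntegral K z) (hdeg : Module.finrank K (IntermediateField.adjoin K {z}) = 3)
    {a b c : K} (h : algebraMap K Ω a * z ^ 2 + algebraMap K Ω b * z + algebraMap K Ω c = 0) :
    a = 0 ∧ b = 0 ∧ c = 0 := by
  rw [IntermediateField.adjoin.finrank hz] at hdeg
  have hp : C a * X ^ 2 + C b * X + C c = (0 : K[X]) := by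
    refine eq_zero_of_dvd_of_natDegree_lt (minpoly.dvd K z (by simpa using h)) ?_
    exact natDegree_quadratic_le.trans_lt (by omega)
  refine ⟨?_, ?_, ?_⟩
  · simpa using congrArg (fun p => p.coeff 2) hp
  · simpa using congrArg (fun p => p.coeff 1) hp
  · simpa using congrArg (fun p => p.coeff 0) hp

/-- Every element of a simple extension of degree `3` is a quadratic expression in the generator. -/
theorem exists_quadratic_of_mem_adjoin {K Ω : Type*} [Field K] [Field Ω] [Algebra K Ω]
    {z w : Ω} (hz : IsIntegral K z) (hdeg : Module.finrank K (IntermediateField.adjoin K {z}) = 3)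
    (hw : w ∈ IntermediateField.adjoin K {z}) :
    ∃ a b c : K, w = algebraMap K Ω a * z ^ 2 + algebraMap K Ω b * z + algebraMap K Ω c := by
  rw [IntermediateField.adjoin.finrank hz] at hdeg
  rw [← IntermediateField.mem_toSubalgebra,
    IntermediateField.adjoin_simple_toSubalgebra_of_isAlgebraic hz.isAlgebraic,
    Algebra.adjoin_singleton_eq_range_aeval] at hw
  obtain ⟨p, rfl⟩ := hw
  have hr : (p %ₘ minpoly K z).natDegree < 3 :=
    hdeg ▸ natDegree_modByMonic_lt p (minpoly.monic hz) (minpoly.ne_one K z)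
  refine ⟨(p %ₘ minpoly K z).coeff 2, (p %ₘ minpoly K z).coeff 1, (p %ₘ minpoly K z).coeff 0, ?_⟩
  have key : aeval z (p %ₘ minpoly K z) = aeval z p :=
    aeval_modByMonic_eq_self_of_root (minpoly.aeval K z)
  rw [aeval_eq_sum_range' hr] at key
  simp only [Finset.sum_range_succ, Finset.sum_range_zero, Algebra.smul_def] at key
  refine key.symm.trans ?_
  ring

/-- If `z ^ 3 - 3 z = a`, then `φ z ^ 2 + χ z - 2 φ` is a root of an explicit depressed cubic. -/
theorem depressed_cubic_of_cube_sub_three_mul {R : Type*} [CommRing R] {z a : R}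
    (h : z ^ 3 - 3 * z = a) (φ χ : R) :
    (φ * z ^ 2 + χ * z - 2 * φ) ^ 3 -
        3 * (χ ^ 2 + a * φ * χ + φ ^ 2) * (φ * z ^ 2 + χ * z - 2 * φ) =
      (-2 + a ^ 2) * φ ^ 3 + 3 * a * φ ^ 2 * χ + 6 * φ * χ ^ 2 + a * χ ^ 3 := by
  subst h
  ring

/-- Let K be a field of characteristic different from 3 containing no primitive third
root of unity. Let Ω ⊇ K and z₁, z₂ ∈ Ω be such that K(zᵢ)/K is Galois of degree 3 with
zᵢ^3 − 3zᵢ = aᵢ ∈ K. Then K(z₁) = K(z₂) if and only if there exist φ, χ ∈ K with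
χ^2 + a₁φχ + φ^2 = 1 and z₂ = φz₁^2 + χz₁ − 2φ; moreover, for any such φ, χ one has
a₂ = (−2 + a₁^2)φ^3 + 3a₁φ^2χ + 6φχ^2 + a₁χ^3. -/
theorem same_field_criterion_standard_form
    (K Ω : Type*) [Field K] [Field Ω] [Algebra K Ω]
    (hchar : ringChar K ≠ 3)
    (hroot : ¬ ∃ ξ : K, ξ ^ 2 + ξ + 1 = 0)
    (z₁ z₂ : Ω) (a₁ a₂ : K)
    (hgal₁ : IsGalois K (IntermediateField.adjoin K {z₁}))
    (hdeg₁ : Module.finrank K (IntermediateField.adjoin K {z₁}) = 3)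
    (heq₁ : z₁ ^ 3 - 3 * z₁ = algebraMap K Ω a₁)
    (hgal₂ : IsGalois K (IntermediateField.adjoin K {z₂}))
    (hdeg₂ : Module.finrank K (IntermediateField.adjoin K {z₂}) = 3)
    (heq₂ : z₂ ^ 3 - 3 * z₂ = algebraMap K Ω a₂) :
    (IntermediateField.adjoin K {z₁} = IntermediateField.adjoin K {z₂} ↔
      ∃ φ χ : K, χ ^ 2 + a₁ * φ * χ + φ ^ 2 = 1 ∧
        z₂ = algebraMap K Ω φ * z₁ ^ 2 + algebraMap K Ω χ * z₁ -
          2 * algebraMap K Ω φ) ∧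
    (∀ φ χ : K,
      χ ^ 2 + a₁ * φ * χ + φ ^ 2 = 1 →
      z₂ = algebraMap K Ω φ * z₁ ^ 2 + algebraMap K Ω χ * z₁ - 2 * algebraMap K Ω φ →
      a₂ = (-2 + a₁ ^ 2) * φ ^ 3 + 3 * a₁ * φ ^ 2 * χ + 6 * φ * χ ^ 2 + a₁ * χ ^ 3) := by
  have h3 : (3 : K) ≠ 0 := fun h => by
    have hd : ringChar K ∣ 3 := ringChar.dvd (by exact_mod_cast h)
    rcases (Nat.dvd_prime Nat.prime_three).mp hd with h1 | h1
    · exact CharP.ringChar_ne_one h1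
    · exact hchar h1
  have hint : ∀ z : Ω, Module.finrank K (IntermediateField.adjoin K {z}) = 3 → IsIntegral K z := by
    intro z hz
    have : FiniteDimensional K (IntermediateField.adjoin K {z}) :=
      FiniteDimensional.of_finrank_pos (by omega)
    have hg : IsIntegral K (IntermediateField.AdjoinSimple.gen K z) := IsIntegral.of_finite K _
    exact (IntermediateField.AdjoinSimple.isIntegral_gen K z).mp hg
  have hint₁ := hint z₁ hdeg₁
  have hint₂ := hint z₂ hdeg₂
  refine ⟨⟨fun hK => ?_, ?_⟩, ?_⟩
  · obtain ⟨φ, χ, c, hz⟩ := exists_quadratic_of_mem_adjoin hint₁ hdeg₁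
      (hK ▸ IntermediateField.mem_adjoin_simple_self K z₂ : z₂ ∈ IntermediateField.adjoin K {z₁})
    set d := c + 2 * φ with hd
    set Q := χ ^ 2 + a₁ * φ * χ + φ ^ 2 with hQ
    set N := (-2 + a₁ ^ 2) * φ ^ 3 + 3 * a₁ * φ ^ 2 * χ + 6 * φ * χ ^ 2 + a₁ * χ ^ 3 with hN
    have hcubic := depressed_cubic_of_cube_sub_three_mul heq₁ (algebraMap K Ω φ) (algebraMap K Ω χ)
    have hw : algebraMap K Ω φ * z₁ ^ 2 + algebraMap K Ω χ * z₁ - 2 * algebraMap K Ω φ =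
        z₂ - algebraMap K Ω d := by
      rw [hz, hd]
      simp only [map_add, map_mul, map_ofNat]
      ring
    have hrel : algebraMap K Ω (-3 * d) * z₂ ^ 2 + algebraMap K Ω (3 * d ^ 2 - 3 * Q + 3) * z₂ +
        algebraMap K Ω (a₂ - d ^ 3 + 3 * Q * d - N) = 0 := by
      rw [hw] at hcubic
      simp only [hQ, hN, map_add, map_sub, map_mul, map_pow, map_neg, map_ofNat]
      linear_combination hcubic - heq₂
    obtain ⟨hA, hB, -⟩ := coeffs_eq_zero_of_finrank_adjoin_eq_three hint₂ hdeg₂ hrel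
    have hd0 : d = 0 := by simpa [h3] using hA
    refine ⟨φ, χ, mul_left_cancel₀ h3 ?_, ?_⟩
    · rw [hd0] at hB
      linear_combination -hB
    · rw [hw, hd0, map_zero, sub_zero]
  · rintro ⟨φ, χ, -, hz⟩
    have : FiniteDimensional K (IntermediateField.adjoin K {z₁}) :=
      FiniteDimensional.of_finrank_pos (by omega)
    refine (IntermediateField.eq_of_le_of_finrank_eq ?_ (hdeg₂.trans hdeg₁.symm)).symm
    rw [IntermediateField.adjoin_simple_le_iff, hz]
    have hmem := IntermediateField.mem_adjoin_simple_self K z₁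
    have halg := (IntermediateField.adjoin K {z₁}).algebraMap_mem
    exact sub_mem (add_mem (mul_mem (halg φ) (pow_mem hmem 2)) (mul_mem (halg χ) hmem))
      (mul_mem (ofNat_mem _ 2) (halg φ))
  · intro φ χ hQ hz
    have hcubic := depressed_cubic_of_cube_sub_three_mul heq₁ (algebraMap K Ω φ) (algebraMap K Ω χ)
    have hQ' := congrArg (algebraMap K Ω) hQ
    apply (algebraMap K Ω).injective
    rw [← hz] at hcubic
    simp only [map_add, map_mul, map_pow, map_neg, map_ofNat, map_one] at hQ' ⊢
    linear_combination hcubic - heq₂ + 3 * z₂ * hQ'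
end
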